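/- There exists a constant C > 0, depending only on T, α, β, K and δ, such that for every classical solution (v,u,θ,w,b) of the planar compressible MHD system on ℝ × [0,T] with (K,δ)-admissible initial data, one has θ(x,t) ≥ C⁻¹ for all (x,t) ∈ ℝ × [0,T]. -/

import Mathlib

open MeasureTheory Set Filter

noncomputable section

/-- Viscosity function `μ(z) = 1 + α z^(−α)` (here `μ̃₁ = 1`, `μ̃₂ = α`). -/
def visc (α z : ℝ) : ℝ := 1 + α * z ^ (-α)

/-- Squared Euclidean norm on `ℝ × ℝ` (used for the transverse fields `w, b ∈ ℝ²`). -/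
def sq2 (p : ℝ × ℝ) : ℝ := p.1 ^ 2 + p.2 ^ 2

/-- Partial derivative with respect to the first (spatial) variable. -/
def pdx {E : Type*} [NormedAddCommGroup E] [NormedSpace ℝ E]
    (f : ℝ → ℝ → E) (x t : ℝ) : E := deriv (fun y => f y t) x

/-- Partial derivative with respect to the second (time) variable, taken within `[0, T]`
(so it is one-sided at the endpoints). -/
def pdt (T : ℝ) {E : Type*} [NormedAddCommGroup E] [NormedSpace ℝ E]
    (f : ℝ → ℝ → E) (x t : ℝ) : E := derivWithin (fun s => f x s) (Icc 0 T) t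

/-- A classical solution of the planar compressible MHD system (in Lagrangian coordinates,
with all physical constants normalized to `1` and `μ̃₂ = α`) on `ℝ × [0,T]`:
all the derivatives appearing in the equations exist and are continuous, `v, θ > 0`,
the five equations hold pointwise, the solution tends to `(1,0,1,0,0)` as `|x| → ∞`
uniformly in `t ∈ [0,T]`, and `v−1, u, θ−1, b, w` and their first spatial derivatives
are square-integrable in `x` for each `t ∈ [0,T]`. -/
structure IsClassicalSolution (α β T : ℝ) (v u θ : ℝ → ℝ → ℝ)
    (w b : ℝ → ℝ → ℝ × ℝ) : Prop where
  v_pos : ∀ x : ℝ, ∀ t ∈ Icc (0:ℝ) T, 0 < v x t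
  θ_pos : ∀ x : ℝ, ∀ t ∈ Icc (0:ℝ) T, 0 < θ x t
  diff_x : ∀ x : ℝ, ∀ t ∈ Icc (0:ℝ) T,
    DifferentiableAt ℝ (fun y => v y t) x ∧ DifferentiableAt ℝ (fun y => u y t) x ∧
    DifferentiableAt ℝ (fun y => θ y t) x ∧ DifferentiableAt ℝ (fun y => w y t) x ∧
    DifferentiableAt ℝ (fun y => b y t) x
  diff_xx : ∀ x : ℝ, ∀ t ∈ Icc (0:ℝ) T,
    DifferentiableAt ℝ (fun y => pdx u y t) x ∧ DifferentiableAt ℝ (fun y => pdx θ y t) x ∧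
    DifferentiableAt ℝ (fun y => pdx w y t) x ∧ DifferentiableAt ℝ (fun y => pdx b y t) x
  diff_t : ∀ x : ℝ, ∀ t ∈ Icc (0:ℝ) T,
    DifferentiableWithinAt ℝ (fun s => v x s) (Icc 0 T) t ∧
    DifferentiableWithinAt ℝ (fun s => u x s) (Icc 0 T) t ∧
    DifferentiableWithinAt ℝ (fun s => θ x s) (Icc 0 T) t ∧
    DifferentiableWithinAt ℝ (fun s => w x s) (Icc 0 T) t ∧
    DifferentiableWithinAt ℝ (fun s => b x s) (Icc 0 T) t
  cont : ContinuousOn (fun p : ℝ × ℝ =>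
      (v p.1 p.2, u p.1 p.2, θ p.1 p.2, w p.1 p.2, b p.1 p.2)) (univ ×ˢ Icc 0 T)
  cont_dx : ContinuousOn (fun p : ℝ × ℝ =>
      (pdx v p.1 p.2, pdx u p.1 p.2, pdx θ p.1 p.2, pdx w p.1 p.2, pdx b p.1 p.2))
      (univ ×ˢ Icc 0 T)
  cont_dxx : ContinuousOn (fun p : ℝ × ℝ =>
      (pdx (pdx u) p.1 p.2, pdx (pdx θ) p.1 p.2, pdx (pdx w) p.1 p.2, pdx (pdx b) p.1 p.2))
      (univ ×ˢ Icc 0 T)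
  cont_dt : ContinuousOn (fun p : ℝ × ℝ =>
      (pdt T v p.1 p.2, pdt T u p.1 p.2, pdt T θ p.1 p.2, pdt T w p.1 p.2, pdt T b p.1 p.2))
      (univ ×ˢ Icc 0 T)
  eq_mass : ∀ x : ℝ, ∀ t ∈ Icc (0:ℝ) T, pdt T v x t = pdx u x t
  eq_mom : ∀ x : ℝ, ∀ t ∈ Icc (0:ℝ) T,
    pdt T u x t + pdx (fun y s => θ y s / v y s + sq2 (b y s) / 2) x t
      = pdx (fun y s => visc α (v y s) * pdx u y s / v y s) x t
  eq_w : ∀ x : ℝ, ∀ t ∈ Icc (0:ℝ) T,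
    pdt T w x t - pdx b x t = pdx (fun y s => (v y s)⁻¹ • pdx w y s) x t
  eq_b : ∀ x : ℝ, ∀ t ∈ Icc (0:ℝ) T,
    pdt T (fun y s => v y s • b y s) x t - pdx w x t
      = pdx (fun y s => (v y s)⁻¹ • pdx b y s) x t
  eq_temp : ∀ x : ℝ, ∀ t ∈ Icc (0:ℝ) T,
    pdt T θ x t + θ x t / v x t * pdx u x t
      = pdx (fun y s => θ y s ^ β * pdx θ y s / v y s) x t
        + (visc α (v x t) * pdx u x t ^ 2 + sq2 (pdx w x t) + sq2 (pdx b x t)) / v x t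
  farfield : ∀ ε > (0:ℝ), ∃ M : ℝ, ∀ x : ℝ, ∀ t ∈ Icc (0:ℝ) T, M ≤ |x| →
    |v x t - 1| < ε ∧ |u x t| < ε ∧ |θ x t - 1| < ε ∧
    Real.sqrt (sq2 (b x t)) < ε ∧ Real.sqrt (sq2 (w x t)) < ε
  sq_int : ∀ t ∈ Icc (0:ℝ) T,
    Integrable (fun x => (v x t - 1) ^ 2) ∧ Integrable (fun x => (u x t) ^ 2) ∧
    Integrable (fun x => (θ x t - 1) ^ 2) ∧ Integrable (fun x => sq2 (b x t)) ∧
    Integrable (fun x => sq2 (w x t)) ∧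
    Integrable (fun x => (pdx v x t) ^ 2) ∧ Integrable (fun x => (pdx u x t) ^ 2) ∧
    Integrable (fun x => (pdx θ x t) ^ 2) ∧ Integrable (fun x => sq2 (pdx b x t)) ∧
    Integrable (fun x => sq2 (pdx w x t))

/-- The initial data of a solution are `(K, δ)`-admissible: the `H¹`-type norm of
`(v₀−1, u₀, θ₀−1, b₀, w₀)` is at most `K²` and `v₀ ≥ δ`, `θ₀ ≥ δ`. -/
def Admissible (K δ : ℝ) (v u θ : ℝ → ℝ → ℝ) (w b : ℝ → ℝ → ℝ × ℝ) : Prop :=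
  (∫ x : ℝ, ((v x 0 - 1) ^ 2 + (u x 0) ^ 2 + (θ x 0 - 1) ^ 2 + sq2 (b x 0) + sq2 (w x 0)
      + (pdx v x 0) ^ 2 + (pdx u x 0) ^ 2 + (pdx θ x 0) ^ 2
      + sq2 (pdx b x 0) + sq2 (pdx w x 0))) ≤ K ^ 2 ∧
  (∀ x : ℝ, δ ≤ v x 0) ∧ (∀ x : ℝ, δ ≤ θ x 0)

/-! ### Calculus on the strip `ℝ × [0, T]` -/

theorem exists_continuous_extension_strip {T : ℝ} (hT : 0 ≤ T) {f : ℝ × ℝ → ℝ}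
    (hf : ContinuousOn f (univ ×ˢ Icc 0 T)) :
    ∃ F : ℝ → ℝ → ℝ, Continuous (Function.uncurry F) ∧
      ∀ x, ∀ t ∈ Icc (0:ℝ) T, F x t = f (x, t) := by
  refine ⟨fun x t => f (x, max 0 (min t T)), ?_, ?_⟩
  · have h : Continuous (fun p : ℝ × ℝ => (p.1, max 0 (min p.2 T))) := by fun_prop
    exact hf.comp_continuous h (fun p => ⟨mem_univ _, le_max_left _ _,
      max_le hT (min_le_right _ _)⟩)
  · intro x t ht
    simp only [min_eq_left ht.2, max_eq_right ht.1]

theorem continuous_slice_of_strip {T t : ℝ} {f : ℝ × ℝ → ℝ}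
    (hf : ContinuousOn f (univ ×ˢ Icc 0 T)) (ht : t ∈ Icc (0:ℝ) T) :
    Continuous (fun x => f (x, t)) :=
  hf.comp_continuous (by fun_prop) (fun _ => ⟨mem_univ _, ht⟩)

theorem continuousOn_slice_of_strip {T : ℝ} {f : ℝ × ℝ → ℝ}
    (hf : ContinuousOn f (univ ×ˢ Icc 0 T)) (x : ℝ) :
    ContinuousOn (fun t => f (x, t)) (Icc 0 T) :=
  hf.comp (by fun_prop) (fun _ ht => ⟨mem_univ _, ht⟩)

theorem integral_eq_sub_of_hasDerivWithinAt_Icc {T t : ℝ} (ht : t ∈ Icc (0:ℝ) T) {f f' : ℝ → ℝ}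
    (hd : ∀ s ∈ Icc (0:ℝ) T, HasDerivWithinAt f (f' s) (Icc 0 T) s)
    (hc : ContinuousOn f' (Icc 0 T)) : ∫ s in (0:ℝ)..t, f' s = f t - f 0 := by
  have hsub : Icc (0:ℝ) t ⊆ Icc 0 T := Icc_subset_Icc_right ht.2
  apply intervalIntegral.integral_eq_sub_of_hasDerivAt_of_le ht.1
  · exact fun s hs => ((hd s (hsub hs)).mono hsub).continuousWithinAt
  · intro s hs
    exact (hd s (hsub (Ioo_subset_Icc_self hs))).hasDerivAt
      (Icc_mem_nhds hs.1 (hs.2.trans_le ht.2))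
  · apply ContinuousOn.intervalIntegrable
    rw [uIcc_of_le ht.1]
    exact hc.mono hsub

theorem continuousOn_integral_of_strip {T : ℝ} (hT : 0 ≤ T) (a b : ℝ) {f : ℝ × ℝ → ℝ}
    (hf : ContinuousOn f (univ ×ˢ Icc 0 T)) :
    ContinuousOn (fun s => ∫ x in a..b, f (x, s)) (Icc 0 T) := by
  obtain ⟨F, hF, hFf⟩ := exists_continuous_extension_strip hT hf
  have h : Continuous (fun s => ∫ x in a..b, F x s) := by
    apply intervalIntegral.continuous_parametric_intervalIntegral_of_continuous'
      (f := fun s x => F x s)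
    exact hF.comp continuous_swap
  refine h.continuousOn.congr fun s hs => ?_
  exact intervalIntegral.integral_congr fun x _ => (hFf x s hs).symm

theorem integral_sub_eq_integral_integral_deriv {T t : ℝ} (ht : t ∈ Icc (0:ℝ) T) (a b : ℝ)
    {g g' : ℝ → ℝ → ℝ}
    (hd : ∀ x, ∀ s ∈ Icc (0:ℝ) T, HasDerivWithinAt (g x) (g' x s) (Icc 0 T) s)
    (hc : ContinuousOn (fun p : ℝ × ℝ => g' p.1 p.2) (univ ×ˢ Icc 0 T)) :
    ∫ x in a..b, (g x t - g x 0) = ∫ s in (0:ℝ)..t, ∫ x in a..b, g' x s := by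
  have hT : 0 ≤ T := ht.1.trans ht.2
  obtain ⟨F, hF, hFf⟩ := exists_continuous_extension_strip hT hc
  have hmem : ∀ s ∈ uIcc 0 t, s ∈ Icc (0:ℝ) T := by
    intro s hs
    rw [uIcc_of_le ht.1] at hs
    exact ⟨hs.1, hs.2.trans ht.2⟩
  have h1 : ∀ x, g x t - g x 0 = ∫ s in (0:ℝ)..t, F x s := by
    intro x
    rw [← integral_eq_sub_of_hasDerivWithinAt_Icc ht (hd x) (continuousOn_slice_of_strip hc x)]
    exact intervalIntegral.integral_congr fun s hs => (hFf x s (hmem s hs)).symm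
  simp_rw [h1]
  rw [intervalIntegral_intervalIntegral_swap]
  · exact intervalIntegral.integral_congr fun s hs =>
      intervalIntegral.integral_congr fun x _ => hFf x s (hmem s hs)
  · have h2 : IntegrableOn (Function.uncurry F) (uIcc a b ×ˢ uIcc 0 t) (volume.prod volume) :=
      hF.continuousOn.integrableOn_compact (isCompact_uIcc.prod isCompact_uIcc)
    exact h2.mono_set (prod_mono uIoc_subset_uIcc uIoc_subset_uIcc)

theorem le_mul_exp_of_eq_add_integral {T C z₀ : ℝ} {z q : ℝ → ℝ} (hq : Continuous q)
    (hz : ∀ t ∈ Icc (0:ℝ) T, z t = z₀ + ∫ s in (0:ℝ)..t, q s)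
    (hle : ∀ t ∈ Icc (0:ℝ) T, q t ≤ C * z t) {t : ℝ} (ht : t ∈ Icc (0:ℝ) T) :
    z t ≤ z₀ * Real.exp (C * t) := by
  set y : ℝ → ℝ := fun t => (z₀ + ∫ s in (0:ℝ)..t, q s) * Real.exp (-(C * t)) with hy
  have hd : ∀ t, HasDerivAt y ((q t - C * (z₀ + ∫ s in (0:ℝ)..t, q s))
      * Real.exp (-(C * t))) t := by
    intro t
    have h1 : HasDerivAt (fun t => z₀ + ∫ s in (0:ℝ)..t, q s) (q t) t :=
      (intervalIntegral.integral_hasDerivAt_right (hq.intervalIntegrable _ _)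
        (hq.stronglyMeasurableAtFilter _ _) hq.continuousAt).const_add z₀
    have h2 : HasDerivAt (fun t => Real.exp (-(C * t))) (Real.exp (-(C * t)) * (-(C * 1))) t :=
      (((hasDerivAt_id t).const_mul C).neg).exp
    exact (h1.mul h2).congr_deriv (by ring)
  have hanti : AntitoneOn y (Icc 0 T) := by
    apply antitoneOn_of_deriv_nonpos (convex_Icc _ _)
    · exact fun s _ => (hd s).continuousAt.continuousWithinAt
    · exact fun s _ => (hd s).differentiableAt.differentiableWithinAt
    · intro s hs
      have hs' : s ∈ Icc (0:ℝ) T := interior_subset hs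
      rw [(hd s).deriv, ← hz s hs']
      exact mul_nonpos_of_nonpos_of_nonneg (by linarith [hle s hs']) (Real.exp_pos _).le
  have h0 := hanti (left_mem_Icc.2 (ht.1.trans ht.2)) ht ht.1
  simp only [hy, ← hz t ht, intervalIntegral.integral_same, mul_zero, neg_zero, Real.exp_zero,
    add_zero, mul_one] at h0
  calc z t = z t * Real.exp (-(C * t)) * Real.exp (C * t) := by
        rw [mul_assoc, ← Real.exp_add]; simp
    _ ≤ z₀ * Real.exp (C * t) := by gcongr

theorem abs_mul_abs_le_of_tendsto_zero {T ε : ℝ} (hε : 0 < ε) {g : ℝ × ℝ → ℝ}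
    (hg : ContinuousOn g (univ ×ˢ Icc 0 T))
    (h0 : Tendsto g (cocompact ℝ ×ˢ 𝓟 (Icc 0 T)) (nhds 0)) :
    ∃ C : ℝ, 0 ≤ C ∧ ∀ x, ∀ t ∈ Icc (0:ℝ) T, |x| * |g (x, t)| ≤ C + ε * |x| := by
  have h1 : ∀ᶠ p in cocompact ℝ ×ˢ 𝓟 (Icc 0 T), |g p| < ε := by
    have := h0.eventually (Metric.ball_mem_nhds 0 hε)
    simpa [Real.dist_eq] using this
  rw [eventually_prod_principal_iff] at h1
  obtain ⟨s, hs, hsub⟩ := mem_cocompact.1 h1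
  obtain ⟨C, hC⟩ := (hs.prod isCompact_Icc).exists_bound_of_continuousOn
    (f := fun p : ℝ × ℝ => |p.1| * |g p|) (s := s ×ˢ Icc (0:ℝ) T)
    ((by fun_prop : Continuous fun p : ℝ × ℝ => |p.1|).continuousOn.mul
      (hg.mono (prod_mono (subset_univ _) Subset.rfl)).abs)
  refine ⟨|C|, abs_nonneg C, fun x t ht => ?_⟩
  by_cases hx : x ∈ s
  · have := hC (x, t) ⟨hx, ht⟩
    rw [Real.norm_eq_abs] at this
    have h3 := (le_abs_self _).trans (this.trans (le_abs_self C))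
    have : 0 ≤ ε * |x| := by positivity
    simp only at h3
    linarith
  · have : |g (x, t)| < ε := hsub hx t ht
    nlinarith [abs_nonneg x, abs_nonneg C]

theorem nonneg_of_isLocalMin_of_hasDerivAt_deriv {f : ℝ → ℝ} {x f'' : ℝ} (hmin : IsLocalMin f x)
    (hc : ContinuousAt f x) (h : HasDerivAt (deriv f) f'' x) : 0 ≤ f'' := by
  by_contra! hneg
  have hmax : IsLocalMax f x :=
    isLocalMax_of_deriv_deriv_neg (by rwa [h.deriv]) hmin.deriv_eq_zero hc
  have heq : f =ᶠ[nhds x] fun _ => f x := by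
    filter_upwards [hmin, hmax] with y h1 h2 using le_antisymm h2 h1
  have : deriv (deriv f) x = 0 := by
    rw [heq.deriv.deriv_eq]
    simp
  rw [h.deriv] at this
  exact hneg.ne this

/-! ### Scalar form of the system -/

theorem hasDerivAt_fst_component {f : ℝ → ℝ × ℝ} {f' : ℝ × ℝ} {x : ℝ} (h : HasDerivAt f f' x) :
    HasDerivAt (fun y => (f y).1) f'.1 x :=
  (ContinuousLinearMap.fst ℝ ℝ ℝ).hasFDerivAt.comp_hasDerivAt x h

theorem hasDerivAt_snd_component {f : ℝ → ℝ × ℝ} {f' : ℝ × ℝ} {x : ℝ} (h : HasDerivAt f f' x) :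
    HasDerivAt (fun y => (f y).2) f'.2 x :=
  (ContinuousLinearMap.snd ℝ ℝ ℝ).hasFDerivAt.comp_hasDerivAt x h

theorem hasDerivWithinAt_fst_component {f : ℝ → ℝ × ℝ} {f' : ℝ × ℝ} {s : Set ℝ} {x : ℝ}
    (h : HasDerivWithinAt f f' s x) : HasDerivWithinAt (fun y => (f y).1) f'.1 s x :=
  (ContinuousLinearMap.fst ℝ ℝ ℝ).hasFDerivAt.comp_hasDerivWithinAt x h

theorem hasDerivWithinAt_snd_component {f : ℝ → ℝ × ℝ} {f' : ℝ × ℝ} {s : Set ℝ} {x : ℝ}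
    (h : HasDerivWithinAt f f' s x) : HasDerivWithinAt (fun y => (f y).2) f'.2 s x :=
  (ContinuousLinearMap.snd ℝ ℝ ℝ).hasFDerivAt.comp_hasDerivWithinAt x h

theorem visc_ge_one {α z : ℝ} (hα : 0 ≤ α) (hz : 0 ≤ z) : 1 ≤ visc α z :=
  le_add_of_nonneg_right (mul_nonneg hα (Real.rpow_nonneg hz _))

/-- Total pressure `θ / v + |b|² / 2`. -/
def totalPressure (v θ : ℝ → ℝ → ℝ) (b : ℝ → ℝ → ℝ × ℝ) (x t : ℝ) : ℝ :=
  θ x t / v x t + sq2 (b x t) / 2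

/-- Viscous stress `μ(v) u_x / v`. -/
def viscousStress (α : ℝ) (v u : ℝ → ℝ → ℝ) (x t : ℝ) : ℝ :=
  visc α (v x t) * pdx u x t / v x t

/-- Heat production `μ(v) u_x² + |w_x|² + |b_x|²`. -/
def heating (α : ℝ) (v u : ℝ → ℝ → ℝ) (w b : ℝ → ℝ → ℝ × ℝ) (x t : ℝ) : ℝ :=
  visc α (v x t) * pdx u x t ^ 2 + sq2 (pdx w x t) + sq2 (pdx b x t)

namespace IsClassicalSolution

variable {α β T : ℝ} {v u θ : ℝ → ℝ → ℝ} {w b : ℝ → ℝ → ℝ × ℝ}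

section Derivatives

variable (h : IsClassicalSolution α β T v u θ w b) (hT : 0 < T) (x : ℝ) {t : ℝ}
  (ht : t ∈ Icc (0:ℝ) T)
include h ht

theorem hasDerivAt_v : HasDerivAt (fun y => v y t) (pdx v x t) x :=
  (h.diff_x x t ht).1.hasDerivAt

theorem hasDerivAt_u : HasDerivAt (fun y => u y t) (pdx u x t) x :=
  (h.diff_x x t ht).2.1.hasDerivAt

theorem hasDerivAt_θ : HasDerivAt (fun y => θ y t) (pdx θ x t) x :=
  (h.diff_x x t ht).2.2.1.hasDerivAt

theorem hasDerivAt_w : HasDerivAt (fun y => w y t) (pdx w x t) x :=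
  (h.diff_x x t ht).2.2.2.1.hasDerivAt

theorem hasDerivAt_b : HasDerivAt (fun y => b y t) (pdx b x t) x :=
  (h.diff_x x t ht).2.2.2.2.hasDerivAt

theorem hasDerivAt_pdx_θ : HasDerivAt (fun y => pdx θ y t) (pdx (pdx θ) x t) x :=
  (h.diff_xx x t ht).2.1.hasDerivAt

theorem hasDerivAt_totalPressure : HasDerivAt (fun y => totalPressure v θ b y t)
    (pdx (totalPressure v θ b) x t) x := by
  have hb := h.hasDerivAt_b x ht
  have h1 := hasDerivAt_fst_component hb
  have h2 := hasDerivAt_snd_component hb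
  have := ((h.hasDerivAt_θ x ht).div (h.hasDerivAt_v x ht) (h.v_pos x t ht).ne').add
    (((h1.pow 2).add (h2.pow 2)).div_const 2)
  exact this.differentiableAt.hasDerivAt

theorem hasDerivAt_viscousStress : HasDerivAt (fun y => viscousStress α v u y t)
    (pdt T u x t + pdx (totalPressure v θ b) x t) x := by
  have hv := h.hasDerivAt_v x ht
  have hv0 := (h.v_pos x t ht).ne'
  have hvisc : HasDerivAt (fun y => visc α (v y t)) _ x :=
    ((hv.rpow_const (p := -α) (Or.inl hv0)).const_mul α).const_add 1
  have := (hvisc.mul (h.diff_xx x t ht).1.hasDerivAt).div hv hv0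
  exact this.differentiableAt.hasDerivAt.congr_deriv (h.eq_mom x t ht).symm

theorem hasDerivAt_stress_sub_pressure :
    HasDerivAt (fun y => viscousStress α v u y t - totalPressure v θ b y t) (pdt T u x t) x :=
  ((h.hasDerivAt_viscousStress x ht).sub (h.hasDerivAt_totalPressure x ht)).congr_deriv (by ring)

theorem hasDerivAt_w_flux : HasDerivAt (fun y => (v y t)⁻¹ • pdx w y t)
    (pdt T w x t - pdx b x t) x := by
  have := ((h.hasDerivAt_v x ht).inv (h.v_pos x t ht).ne').smul
    (h.diff_xx x t ht).2.2.1.hasDerivAt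
  exact this.differentiableAt.hasDerivAt.congr_deriv (h.eq_w x t ht).symm

theorem hasDerivAt_heat_flux : HasDerivAt (fun y => θ y t ^ β * pdx θ y t / v y t)
    (pdt T θ x t + θ x t / v x t * pdx u x t - heating α v u w b x t / v x t) x := by
  have := (((h.hasDerivAt_θ x ht).rpow_const (p := β) (Or.inl (h.θ_pos x t ht).ne')).mul
    (h.hasDerivAt_pdx_θ x ht)).div (h.hasDerivAt_v x ht) (h.v_pos x t ht).ne'
  refine this.differentiableAt.hasDerivAt.congr_deriv ?_
  have := h.eq_temp x t ht
  simp only [heating]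
  exact (sub_eq_of_eq_add this).symm

theorem hasDerivWithinAt_v : HasDerivWithinAt (v x) (pdx u x t) (Icc 0 T) t :=
  (h.diff_t x t ht).1.hasDerivWithinAt.congr_deriv (h.eq_mass x t ht)

theorem hasDerivWithinAt_u : HasDerivWithinAt (u x) (pdt T u x t) (Icc 0 T) t :=
  (h.diff_t x t ht).2.1.hasDerivWithinAt

theorem hasDerivWithinAt_θ : HasDerivWithinAt (θ x) (pdt T θ x t) (Icc 0 T) t :=
  (h.diff_t x t ht).2.2.1.hasDerivWithinAt

theorem hasDerivWithinAt_w : HasDerivWithinAt (w x) (pdt T w x t) (Icc 0 T) t :=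
  (h.diff_t x t ht).2.2.2.1.hasDerivWithinAt

theorem hasDerivWithinAt_b : HasDerivWithinAt (b x) (pdt T b x t) (Icc 0 T) t :=
  (h.diff_t x t ht).2.2.2.2.hasDerivWithinAt

include hT in
theorem hasDerivAt_b_flux : HasDerivAt (fun y => (v y t)⁻¹ • pdx b y t)
    (v x t • pdt T b x t + pdx u x t • b x t - pdx w x t) x := by
  have := ((h.hasDerivAt_v x ht).inv (h.v_pos x t ht).ne').smul
    (h.diff_xx x t ht).2.2.2.hasDerivAt
  refine this.differentiableAt.hasDerivAt.congr_deriv ((h.eq_b x t ht).symm.trans ?_)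
  have h2 := ((h.hasDerivWithinAt_v x ht).smul (h.hasDerivWithinAt_b x ht)).derivWithin
    (uniqueDiffOn_Icc hT t ht)
  rw [← h2]
  rfl

end Derivatives

section Continuity

variable (h : IsClassicalSolution α β T v u θ w b)
include h

theorem continuousOn_v : ContinuousOn (fun p : ℝ × ℝ => v p.1 p.2) (univ ×ˢ Icc 0 T) :=
  h.cont.fst

theorem continuousOn_u : ContinuousOn (fun p : ℝ × ℝ => u p.1 p.2) (univ ×ˢ Icc 0 T) :=
  h.cont.snd.fst

theorem continuousOn_θ : ContinuousOn (fun p : ℝ × ℝ => θ p.1 p.2) (univ ×ˢ Icc 0 T) :=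
  h.cont.snd.snd.fst

theorem continuousOn_w : ContinuousOn (fun p : ℝ × ℝ => w p.1 p.2) (univ ×ˢ Icc 0 T) :=
  h.cont.snd.snd.snd.fst

theorem continuousOn_b : ContinuousOn (fun p : ℝ × ℝ => b p.1 p.2) (univ ×ˢ Icc 0 T) :=
  h.cont.snd.snd.snd.snd

theorem continuousOn_pdx_u : ContinuousOn (fun p : ℝ × ℝ => pdx u p.1 p.2) (univ ×ˢ Icc 0 T) :=
  h.cont_dx.snd.fst

theorem continuousOn_pdx_θ : ContinuousOn (fun p : ℝ × ℝ => pdx θ p.1 p.2) (univ ×ˢ Icc 0 T) :=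
  h.cont_dx.snd.snd.fst

theorem continuousOn_pdx_w : ContinuousOn (fun p : ℝ × ℝ => pdx w p.1 p.2) (univ ×ˢ Icc 0 T) :=
  h.cont_dx.snd.snd.snd.fst

theorem continuousOn_pdx_b : ContinuousOn (fun p : ℝ × ℝ => pdx b p.1 p.2) (univ ×ˢ Icc 0 T) :=
  h.cont_dx.snd.snd.snd.snd

theorem continuousOn_pdt_u : ContinuousOn (fun p : ℝ × ℝ => pdt T u p.1 p.2) (univ ×ˢ Icc 0 T) :=
  h.cont_dt.snd.fst

theorem continuousOn_pdt_θ : ContinuousOn (fun p : ℝ × ℝ => pdt T θ p.1 p.2) (univ ×ˢ Icc 0 T) :=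
  h.cont_dt.snd.snd.fst

theorem continuousOn_pdt_w : ContinuousOn (fun p : ℝ × ℝ => pdt T w p.1 p.2) (univ ×ˢ Icc 0 T) :=
  h.cont_dt.snd.snd.snd.fst

theorem continuousOn_pdt_b : ContinuousOn (fun p : ℝ × ℝ => pdt T b p.1 p.2) (univ ×ˢ Icc 0 T) :=
  h.cont_dt.snd.snd.snd.snd

theorem continuousOn_totalPressure :
    ContinuousOn (fun p : ℝ × ℝ => totalPressure v θ b p.1 p.2) (univ ×ˢ Icc 0 T) :=
  (h.continuousOn_θ.div h.continuousOn_v fun p hp => (h.v_pos p.1 p.2 hp.2).ne').add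
    (((h.continuousOn_b.fst.pow 2).add (h.continuousOn_b.snd.pow 2)).div_const 2)

theorem continuousOn_viscousStress :
    ContinuousOn (fun p : ℝ × ℝ => viscousStress α v u p.1 p.2) (univ ×ˢ Icc 0 T) := by
  have hv0 : ∀ p ∈ (univ : Set ℝ) ×ˢ Icc 0 T, v p.1 p.2 ≠ 0 :=
    fun p hp => (h.v_pos p.1 p.2 hp.2).ne'
  have hvisc : ContinuousOn (fun p : ℝ × ℝ => visc α (v p.1 p.2)) (univ ×ˢ Icc 0 T) :=
    continuousOn_const.add (continuousOn_const.mul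
      (h.continuousOn_v.rpow_const fun p hp => Or.inl (hv0 p hp)))
  exact (hvisc.mul h.continuousOn_pdx_u).div h.continuousOn_v hv0

/-- The state `(v, u, θ, w, b)` tends to `(1, 0, 1, 0, 0)` at spatial infinity, uniformly in
time. -/
theorem tendsto_state : Tendsto (fun p : ℝ × ℝ =>
    (v p.1 p.2, u p.1 p.2, θ p.1 p.2, w p.1 p.2, b p.1 p.2))
    (cocompact ℝ ×ˢ 𝓟 (Icc 0 T)) (nhds (1, 0, 1, 0, 0)) := by
  rw [Metric.tendsto_nhds]
  intro ε hε
  obtain ⟨M, hM⟩ := h.farfield ε hε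
  rw [eventually_prod_principal_iff]
  have habs : ∀ᶠ x : ℝ in cocompact ℝ, M ≤ |x| :=
    (tendsto_norm_cocompact_atTop (E := ℝ)).eventually_ge_atTop M
  filter_upwards [habs] with x hx t ht
  obtain ⟨h1, h2, h3, h4, h5⟩ := hM x t ht hx
  have key : ∀ p : ℝ × ℝ, Real.sqrt (sq2 p) < ε → |p.1| < ε ∧ |p.2| < ε := by
    intro p hp
    exact ⟨(Real.abs_le_sqrt (by simp only [sq2]; nlinarith [sq_nonneg p.2])).trans_lt hp,
      (Real.abs_le_sqrt (by simp only [sq2]; nlinarith [sq_nonneg p.1])).trans_lt hp⟩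
  simp only [Prod.dist_eq, Real.dist_eq, max_lt_iff, Prod.fst_zero, Prod.snd_zero, sub_zero]
  exact ⟨h1, h2, h3, key _ h5, key _ h4⟩

end Continuity

end IsClassicalSolution

/-! ### The entropy estimate -/

/-- Entropy density of the system relative to the constant state `(1, 0, 1, 0, 0)`. -/
def entropy (v u θ : ℝ → ℝ → ℝ) (w b : ℝ → ℝ → ℝ × ℝ) (x t : ℝ) : ℝ :=
  (v x t - 1 - Real.log (v x t)) + u x t ^ 2 / 2 + (θ x t - 1 - Real.log (θ x t))
    + v x t * sq2 (b x t) / 2 + sq2 (w x t) / 2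

/-- Time derivative of the entropy density. -/
def entropyRate (T : ℝ) (v u θ : ℝ → ℝ → ℝ) (w b : ℝ → ℝ → ℝ × ℝ) (x t : ℝ) : ℝ :=
  pdx u x t * (1 - (v x t)⁻¹) + u x t * pdt T u x t + pdt T θ x t * (1 - (θ x t)⁻¹)
    + (pdx u x t * sq2 (b x t) / 2
      + v x t * ((b x t).1 * (pdt T b x t).1 + (b x t).2 * (pdt T b x t).2))
    + ((w x t).1 * (pdt T w x t).1 + (w x t).2 * (pdt T w x t).2)

/-- Entropy production rate. -/
def entropyProduction (α β : ℝ) (v u θ : ℝ → ℝ → ℝ) (w b : ℝ → ℝ → ℝ × ℝ) (x t : ℝ) : ℝ :=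
  θ x t ^ β * pdx θ x t ^ 2 / (v x t * θ x t ^ 2) + heating α v u w b x t / (v x t * θ x t)

/-- Part of the entropy flux that does not involve derivatives of the state. -/
def hyperbolicFlux (v u θ : ℝ → ℝ → ℝ) (w b : ℝ → ℝ → ℝ × ℝ) (x t : ℝ) : ℝ :=
  u x t * (1 - totalPressure v θ b x t) + ((b x t).1 * (w x t).1 + (b x t).2 * (w x t).2)

/-- Part of the entropy flux that is linear in the spatial derivatives of the state. -/
def dissipativeFlux (α β : ℝ) (v u θ : ℝ → ℝ → ℝ) (w b : ℝ → ℝ → ℝ × ℝ) (x t : ℝ) : ℝ :=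
  u x t * viscousStress α v u x t + (1 - (θ x t)⁻¹) * (θ x t ^ β * pdx θ x t / v x t)
    + ((b x t).1 * ((v x t)⁻¹ • pdx b x t).1 + (b x t).2 * ((v x t)⁻¹ • pdx b x t).2)
    + ((w x t).1 * ((v x t)⁻¹ • pdx w x t).1 + (w x t).2 * ((v x t)⁻¹ • pdx w x t).2)

/-- Weight by which the entropy production controls the dissipative flux. -/
def fluxWeight (α β : ℝ) (v u θ : ℝ → ℝ → ℝ) (w b : ℝ → ℝ → ℝ × ℝ) (x t : ℝ) : ℝ :=
  (visc α (v x t) * u x t ^ 2 * θ x t + (θ x t - 1) ^ 2 * θ x t ^ β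
    + (sq2 (b x t) + sq2 (w x t)) * θ x t) / v x t

theorem sub_one_sub_log_nonneg {z : ℝ} (hz : 0 < z) : 0 ≤ z - 1 - Real.log z := by
  linarith [Real.log_le_sub_one_of_pos hz]

theorem sq2_nonneg (p : ℝ × ℝ) : 0 ≤ sq2 p := add_nonneg (sq_nonneg _) (sq_nonneg _)

namespace IsClassicalSolution

variable {α β T : ℝ} {v u θ : ℝ → ℝ → ℝ} {w b : ℝ → ℝ → ℝ × ℝ}

section Pointwise

variable (h : IsClassicalSolution α β T v u θ w b) (x : ℝ) {t : ℝ} (ht : t ∈ Icc (0:ℝ) T)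
include h ht

theorem entropy_nonneg : 0 ≤ entropy v u θ w b x t := by
  have h1 := sub_one_sub_log_nonneg (h.v_pos x t ht)
  have h2 := sub_one_sub_log_nonneg (h.θ_pos x t ht)
  have h3 := mul_nonneg (h.v_pos x t ht).le (sq2_nonneg (b x t))
  have h4 := sq2_nonneg (w x t)
  have h5 := sq_nonneg (u x t)
  simp only [entropy]
  linarith

theorem sub_one_sub_log_le_entropy : v x t - 1 - Real.log (v x t) ≤ entropy v u θ w b x t := by
  have h2 := sub_one_sub_log_nonneg (h.θ_pos x t ht)
  have h3 := mul_nonneg (h.v_pos x t ht).le (sq2_nonneg (b x t))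
  have h4 := sq2_nonneg (w x t)
  have h5 := sq_nonneg (u x t)
  simp only [entropy]
  linarith

theorem abs_u_le_entropy : |u x t| ≤ entropy v u θ w b x t + 1 / 2 := by
  have h1 := sub_one_sub_log_nonneg (h.v_pos x t ht)
  have h2 := sub_one_sub_log_nonneg (h.θ_pos x t ht)
  have h3 := mul_nonneg (h.v_pos x t ht).le (sq2_nonneg (b x t))
  have h4 := sq2_nonneg (w x t)
  simp only [entropy]
  nlinarith [sq_nonneg (|u x t| - 1), sq_abs (u x t)]

theorem pressure_mul_v_le_entropy :
    totalPressure v θ b x t * v x t ≤ 2 * entropy v u θ w b x t + 2 := by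
  have hv := h.v_pos x t ht
  have hθ := h.θ_pos x t ht
  have h1 := sub_one_sub_log_nonneg hv
  have h2 := Real.log_le_sub_one_of_pos (half_pos hθ)
  rw [Real.log_div hθ.ne' two_ne_zero] at h2
  have h3 := mul_nonneg hv.le (sq2_nonneg (b x t))
  have h4 := sq2_nonneg (w x t)
  have h5 := sq_nonneg (u x t)
  have h6 := Real.log_two_lt_d9
  have h7 : totalPressure v θ b x t * v x t = θ x t + v x t * sq2 (b x t) / 2 := by
    simp only [totalPressure]
    field_simp
  rw [h7]
  simp only [entropy]
  linarith

theorem hasDerivWithinAt_entropy :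
    HasDerivWithinAt (entropy v u θ w b x) (entropyRate T v u θ w b x t) (Icc 0 T) t := by
  have hv := h.hasDerivWithinAt_v x ht
  have hθ := h.hasDerivWithinAt_θ x ht
  have hb1 := hasDerivWithinAt_fst_component (h.hasDerivWithinAt_b x ht)
  have hb2 := hasDerivWithinAt_snd_component (h.hasDerivWithinAt_b x ht)
  have hw1 := hasDerivWithinAt_fst_component (h.hasDerivWithinAt_w x ht)
  have hw2 := hasDerivWithinAt_snd_component (h.hasDerivWithinAt_w x ht)
  have hv0 := (h.v_pos x t ht).ne'
  have hθ0 := (h.θ_pos x t ht).ne'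
  have := ((((hv.sub_const 1).sub (hv.log hv0)).add
    (((h.hasDerivWithinAt_u x ht).pow 2).div_const 2)).add
    ((hθ.sub_const 1).sub (hθ.log hθ0))).add
    ((hv.mul ((hb1.pow 2).add (hb2.pow 2))).div_const 2) |>.add
    (((hw1.pow 2).add (hw2.pow 2)).div_const 2)
  refine this.congr_deriv ?_
  simp only [entropyRate, sq2, Pi.add_apply, Pi.pow_apply]
  field_simp
  ring

theorem hasDerivAt_entropyFlux (hT : 0 < T) : HasDerivAt
    (fun y => hyperbolicFlux v u θ w b y t + dissipativeFlux α β v u θ w b y t)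
    (entropyRate T v u θ w b x t + entropyProduction α β v u θ w b x t) x := by
  have hθ := h.hasDerivAt_θ x ht
  have hbx := h.hasDerivAt_b x ht
  have hwx := h.hasDerivAt_w x ht
  have hbf := h.hasDerivAt_b_flux hT x ht
  have hwf := h.hasDerivAt_w_flux x ht
  have hb1 := hasDerivAt_fst_component hbx
  have hb2 := hasDerivAt_snd_component hbx
  have hw1 := hasDerivAt_fst_component hwx
  have hw2 := hasDerivAt_snd_component hwx
  have hbf1 := hasDerivAt_fst_component hbf
  have hbf2 := hasDerivAt_snd_component hbf
  have hwf1 := hasDerivAt_fst_component hwf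
  have hwf2 := hasDerivAt_snd_component hwf
  have hv0 := (h.v_pos x t ht).ne'
  have hθ0 := (h.θ_pos x t ht).ne'
  have h1 := (((h.hasDerivAt_u x ht).mul ((h.hasDerivAt_totalPressure x ht).const_sub 1)).add
    ((hb1.mul hw1).add (hb2.mul hw2)))
  have h2 := (((h.hasDerivAt_u x ht).mul (h.hasDerivAt_viscousStress x ht)).add
    (((hθ.inv hθ0).const_sub 1).mul (h.hasDerivAt_heat_flux x ht))).add
    ((hb1.mul hbf1).add (hb2.mul hbf2)) |>.add ((hw1.mul hwf1).add (hw2.mul hwf2))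
  refine (h1.add h2).congr_deriv ?_
  simp only [entropyRate, entropyProduction, heating, sq2, viscousStress, totalPressure,
    Prod.fst_add, Prod.snd_add, Prod.fst_sub, Prod.snd_sub, Prod.smul_fst, Prod.smul_snd,
    smul_eq_mul, Pi.inv_apply]
  field_simp
  ring

theorem neg_flux_production_le (hα : 0 ≤ α) (c d : ℝ) :
    -(2 * c * d * (hyperbolicFlux v u θ w b x t + dissipativeFlux α β v u θ w b x t)
      + c ^ 2 * entropyProduction α β v u θ w b x t)
      ≤ 2 * |c| * |d| * |hyperbolicFlux v u θ w b x t|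
        + d ^ 2 * fluxWeight α β v u θ w b x t := by
  have hv := h.v_pos x t ht
  have hθ := h.θ_pos x t ht
  have hm : 0 ≤ visc α (v x t) := zero_le_one.trans (visc_ge_one hα hv.le)
  have hk : 0 ≤ θ x t ^ β := Real.rpow_nonneg hθ.le _
  have hid : d ^ 2 * fluxWeight α β v u θ w b x t
      + 2 * c * d * dissipativeFlux α β v u θ w b x t
      + c ^ 2 * entropyProduction α β v u θ w b x t
      = (visc α (v x t) * θ x t * (d * u x t + c * pdx u x t / θ x t) ^ 2
        + θ x t ^ β * (d * (θ x t - 1) + c * pdx θ x t / θ x t) ^ 2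
        + θ x t * ((d * (b x t).1 + c * (pdx b x t).1 / θ x t) ^ 2
          + (d * (b x t).2 + c * (pdx b x t).2 / θ x t) ^ 2
          + (d * (w x t).1 + c * (pdx w x t).1 / θ x t) ^ 2
          + (d * (w x t).2 + c * (pdx w x t).2 / θ x t) ^ 2)) / v x t := by
    simp only [fluxWeight, dissipativeFlux, entropyProduction, heating, sq2, viscousStress,
      Prod.smul_fst, Prod.smul_snd, smul_eq_mul]
    field_simp
    ring
  have hpos : 0 ≤ d ^ 2 * fluxWeight α β v u θ w b x t
      + 2 * c * d * dissipativeFlux α β v u θ w b x t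
      + c ^ 2 * entropyProduction α β v u θ w b x t := by
    rw [hid]
    positivity
  have habs := neg_abs_le (2 * c * d * hyperbolicFlux v u θ w b x t)
  simp only [abs_mul, abs_two] at habs
  linarith

end Pointwise

section Continuity

variable (h : IsClassicalSolution α β T v u θ w b)
include h

theorem continuousOn_entropy :
    ContinuousOn (fun p : ℝ × ℝ => entropy v u θ w b p.1 p.2) (univ ×ˢ Icc 0 T) := by
  have hv := h.continuousOn_v
  have hu := h.continuousOn_u
  have hθ := h.continuousOn_θ
  have hw := h.continuousOn_w
  have hb := h.continuousOn_b
  have hlv := hv.log fun p hp => (h.v_pos p.1 p.2 hp.2).ne'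
  have hlθ := hθ.log fun p hp => (h.θ_pos p.1 p.2 hp.2).ne'
  simp only [entropy, sq2]
  fun_prop

theorem continuousOn_entropyRate :
    ContinuousOn (fun p : ℝ × ℝ => entropyRate T v u θ w b p.1 p.2) (univ ×ˢ Icc 0 T) := by
  have hv := h.continuousOn_v
  have hu := h.continuousOn_u
  have hθ := h.continuousOn_θ
  have hw := h.continuousOn_w
  have hb := h.continuousOn_b
  have hux := h.continuousOn_pdx_u
  have hut := h.continuousOn_pdt_u
  have hθt := h.continuousOn_pdt_θ
  have hwt := h.continuousOn_pdt_w
  have hbt := h.continuousOn_pdt_b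
  have hv0 : ∀ p ∈ (univ : Set ℝ) ×ˢ Icc 0 T, v p.1 p.2 ≠ 0 :=
    fun p hp => (h.v_pos p.1 p.2 hp.2).ne'
  have hθ0 : ∀ p ∈ (univ : Set ℝ) ×ˢ Icc 0 T, θ p.1 p.2 ≠ 0 :=
    fun p hp => (h.θ_pos p.1 p.2 hp.2).ne'
  simp only [entropyRate, sq2]
  fun_prop (disch := assumption)

theorem continuousOn_entropyProduction :
    ContinuousOn (fun p : ℝ × ℝ => entropyProduction α β v u θ w b p.1 p.2)
      (univ ×ˢ Icc 0 T) := by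
  have hv := h.continuousOn_v
  have hθ := h.continuousOn_θ
  have hux := h.continuousOn_pdx_u
  have hθx := h.continuousOn_pdx_θ
  have hwx := h.continuousOn_pdx_w
  have hbx := h.continuousOn_pdx_b
  have hv0 : ∀ p ∈ (univ : Set ℝ) ×ˢ Icc 0 T, v p.1 p.2 ≠ 0 :=
    fun p hp => (h.v_pos p.1 p.2 hp.2).ne'
  have hθ0 : ∀ p ∈ (univ : Set ℝ) ×ˢ Icc 0 T, θ p.1 p.2 ≠ 0 :=
    fun p hp => (h.θ_pos p.1 p.2 hp.2).ne'
  have hk := hθ.rpow_const (p := β) fun p hp => Or.inl (hθ0 p hp)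
  have hm := hv.rpow_const (p := -α) fun p hp => Or.inl (hv0 p hp)
  simp only [entropyProduction, heating, sq2, visc]
  refine ContinuousOn.add (ContinuousOn.div (by fun_prop) (by fun_prop) ?_)
    (ContinuousOn.div (by fun_prop) (by fun_prop) ?_)
  · exact fun p hp => mul_ne_zero (hv0 p hp) (pow_ne_zero 2 (hθ0 p hp))
  · exact fun p hp => mul_ne_zero (hv0 p hp) (hθ0 p hp)

theorem continuousOn_flux_error :
    ContinuousOn (fun p : ℝ × ℝ => |hyperbolicFlux v u θ w b p.1 p.2|
      + fluxWeight α β v u θ w b p.1 p.2) (univ ×ˢ Icc 0 T) := by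
  have hv := h.continuousOn_v
  have hu := h.continuousOn_u
  have hθ := h.continuousOn_θ
  have hw := h.continuousOn_w
  have hb := h.continuousOn_b
  have hP := h.continuousOn_totalPressure
  have hv0 : ∀ p ∈ (univ : Set ℝ) ×ˢ Icc 0 T, v p.1 p.2 ≠ 0 :=
    fun p hp => (h.v_pos p.1 p.2 hp.2).ne'
  have hθ0 : ∀ p ∈ (univ : Set ℝ) ×ˢ Icc 0 T, θ p.1 p.2 ≠ 0 :=
    fun p hp => (h.θ_pos p.1 p.2 hp.2).ne'
  have hk := hθ.rpow_const (p := β) fun p hp => Or.inl (hθ0 p hp)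
  have hm := hv.rpow_const (p := -α) fun p hp => Or.inl (hv0 p hp)
  simp only [hyperbolicFlux, fluxWeight, sq2, visc]
  exact ContinuousOn.add (ContinuousOn.abs (by fun_prop))
    (ContinuousOn.div (by fun_prop) (by fun_prop) hv0)

theorem tendsto_flux_error :
    Tendsto (fun p : ℝ × ℝ => |hyperbolicFlux v u θ w b p.1 p.2|
      + fluxWeight α β v u θ w b p.1 p.2) (cocompact ℝ ×ˢ 𝓟 (Icc 0 T)) (nhds 0) := by
  let G : ℝ × ℝ × ℝ × (ℝ × ℝ) × (ℝ × ℝ) → ℝ := fun z =>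
    |z.2.1 * (1 - (z.2.2.1 / z.1 + (z.2.2.2.2.1 ^ 2 + z.2.2.2.2.2 ^ 2) / 2))
      + (z.2.2.2.2.1 * z.2.2.2.1.1 + z.2.2.2.2.2 * z.2.2.2.1.2)|
    + ((1 + α * z.1 ^ (-α)) * z.2.1 ^ 2 * z.2.2.1 + (z.2.2.1 - 1) ^ 2 * z.2.2.1 ^ β
      + ((z.2.2.2.2.1 ^ 2 + z.2.2.2.2.2 ^ 2) + (z.2.2.2.1.1 ^ 2 + z.2.2.2.1.2 ^ 2))
        * z.2.2.1) / z.1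
  have hG : ContinuousAt G (1, 0, 1, 0, 0) := by
    have h1 : ContinuousAt (fun z : ℝ × ℝ × ℝ × (ℝ × ℝ) × (ℝ × ℝ) => z.1 ^ (-α))
        (1, 0, 1, 0, 0) := continuousAt_fst.rpow_const (Or.inl one_ne_zero)
    have h2 : ContinuousAt (fun z : ℝ × ℝ × ℝ × (ℝ × ℝ) × (ℝ × ℝ) => z.2.2.1 ^ β)
        (1, 0, 1, 0, 0) :=
      ContinuousAt.rpow_const (by fun_prop) (Or.inl one_ne_zero)
    have h3 : ContinuousAt (fun z : ℝ × ℝ × ℝ × (ℝ × ℝ) × (ℝ × ℝ) => z.2.2.1 / z.1)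
        (1, 0, 1, 0, 0) := ContinuousAt.div (by fun_prop) (by fun_prop) one_ne_zero
    exact ContinuousAt.add (ContinuousAt.abs (by fun_prop))
      (ContinuousAt.div (by fun_prop) (by fun_prop) one_ne_zero)
  have hG0 : G (1, 0, 1, 0, 0) = 0 := by simp [G]
  have := hG.tendsto.comp h.tendsto_state
  rw [hG0] at this
  exact this

end Continuity

theorem integral_weighted_entropyRate_le (h : IsClassicalSolution α β T v u θ w b) (hα : 0 ≤ α)
    (hT : 0 < T) {t R C ε : ℝ} (ht : t ∈ Icc (0:ℝ) T) (hR : 1 ≤ R) (hε : 0 ≤ ε)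
    (herr : ∀ x, |x| * abs (|hyperbolicFlux v u θ w b x t| + fluxWeight α β v u θ w b x t)
      ≤ C + ε * |x|) :
    ∫ x in -R..R, (1 - x ^ 2 / R ^ 2) ^ 2 * entropyRate T v u θ w b x t
      ≤ 8 * (C / R + ε) := by
  have hR0 : 0 < R := by linarith
  set c : ℝ → ℝ := fun x => 1 - x ^ 2 / R ^ 2 with hc
  set d : ℝ → ℝ := fun x => -(2 * x / R ^ 2) with hd
  have hcd : ∀ x, HasDerivAt c (d x) x := by
    intro x
    have := ((hasDerivAt_pow 2 x).div_const (R ^ 2)).const_sub 1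
    exact this.congr_deriv (by simp [hd])
  have hrate : Continuous (fun x => entropyRate T v u θ w b x t) :=
    continuous_slice_of_strip h.continuousOn_entropyRate ht
  have hprod : Continuous (fun x => entropyProduction α β v u θ w b x t) :=
    continuous_slice_of_strip h.continuousOn_entropyProduction ht
  set F : ℝ → ℝ := fun y => hyperbolicFlux v u θ w b y t + dissipativeFlux α β v u θ w b y t
    with hF
  have hFd : ∀ x, HasDerivAt F _ x := fun x => h.hasDerivAt_entropyFlux x ht hT
  have hFc : Continuous F := continuous_iff_continuousAt.2 fun x => (hFd x).continuousAt
  have hcc : Continuous c := continuous_iff_continuousAt.2 fun x => (hcd x).continuousAt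
  have hdc : Continuous d := by simp only [hd]; fun_prop
  have hftc : ∫ x in -R..R, (2 * c x * d x * F x + c x ^ 2 * (entropyRate T v u θ w b x t
      + entropyProduction α β v u θ w b x t)) = 0 := by
    rw [intervalIntegral.integral_eq_sub_of_hasDerivAt (f := fun x => c x ^ 2 * F x)]
    · have hcR : c R = 0 := by simp only [hc]; field_simp; ring
      have hcR' : c (-R) = 0 := by simp only [hc, neg_sq]; field_simp; ring
      simp [hcR, hcR']
    · intro x _
      exact (((hcd x).pow 2).mul (hFd x)).congr_deriv (by simp)
    · exact Continuous.intervalIntegrable (by fun_prop) _ _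
  have hpt : ∀ x ∈ Icc (-R) R, -(2 * c x * d x * F x
      + c x ^ 2 * entropyProduction α β v u θ w b x t) ≤ 4 / R ^ 2 * (C + ε * R) := by
    intro x hx
    have hxR : |x| ≤ R := abs_le.2 hx
    have hx2 : x ^ 2 ≤ R ^ 2 := sq_le_sq' hx.1 hx.2
    have hc1 : |c x| ≤ 1 := by
      have h1 : x ^ 2 / R ^ 2 ≤ 1 := (div_le_one (by positivity)).2 hx2
      have h2 : 0 ≤ x ^ 2 / R ^ 2 := by positivity
      rw [abs_le]
      constructor <;> simp only [hc] <;> linarith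
    have hd1 : |d x| = 2 * |x| / R ^ 2 := by
      simp only [hd, abs_neg, abs_div, abs_mul, abs_two, abs_pow, abs_of_pos hR0]
    have hd2 : |d x| ≤ 2 := by
      rw [hd1, div_le_iff₀ (by positivity)]
      nlinarith
    have hN : 0 ≤ fluxWeight α β v u θ w b x t := by
      have hv := h.v_pos x t ht
      have hθ := h.θ_pos x t ht
      have hm : 0 ≤ visc α (v x t) := zero_le_one.trans (visc_ge_one hα hv.le)
      have hk : 0 ≤ θ x t ^ β := Real.rpow_nonneg hθ.le _
      have h1 := sq2_nonneg (b x t)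
      have h2 := sq2_nonneg (w x t)
      simp only [fluxWeight]
      positivity
    have hF0 := abs_nonneg (hyperbolicFlux v u θ w b x t)
    have he := herr x
    rw [abs_of_nonneg (add_nonneg hF0 hN)] at he
    calc -(2 * c x * d x * F x + c x ^ 2 * entropyProduction α β v u θ w b x t)
        ≤ 2 * |c x| * |d x| * |hyperbolicFlux v u θ w b x t|
          + d x ^ 2 * fluxWeight α β v u θ w b x t := h.neg_flux_production_le x ht hα _ _
      _ ≤ 2 * 1 * |d x| * |hyperbolicFlux v u θ w b x t|
          + (2 * |d x|) * fluxWeight α β v u θ w b x t := by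
        rw [← sq_abs (d x)]
        gcongr
        nlinarith [abs_nonneg (d x)]
      _ = 4 / R ^ 2 * (|x| * (|hyperbolicFlux v u θ w b x t|
          + fluxWeight α β v u θ w b x t)) := by rw [hd1]; ring
      _ ≤ 4 / R ^ 2 * (C + ε * R) := by
        gcongr
        exact he.trans (by gcongr)
  have hsplit : ∫ x in -R..R, c x ^ 2 * entropyRate T v u θ w b x t
      = ∫ x in -R..R, -(2 * c x * d x * F x
        + c x ^ 2 * entropyProduction α β v u θ w b x t) := by
    rw [← sub_eq_zero, ← intervalIntegral.integral_sub, ← hftc]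
    · refine intervalIntegral.integral_congr fun x _ => ?_
      ring
    · exact Continuous.intervalIntegrable (by fun_prop) _ _
    · exact Continuous.intervalIntegrable (by fun_prop) _ _
  rw [hsplit]
  calc _ ≤ ∫ x in -R..R, 4 / R ^ 2 * (C + ε * R) := by
        apply intervalIntegral.integral_mono_on (by linarith) _ _ hpt
        · exact Continuous.intervalIntegrable (by fun_prop) _ _
        · exact intervalIntegrable_const
    _ = 8 * (C / R + ε) := by
        rw [intervalIntegral.integral_const, smul_eq_mul]
        field_simp
        ring

/-- Local control of the entropy in terms of its initial value. -/
theorem integral_entropy_le (h : IsClassicalSolution α β T v u θ w b) (hα : 0 ≤ α)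
    (hT : 0 < T) {E₀ : ℝ} (hE₀ : ∀ R : ℝ, 0 ≤ R → ∫ x in -R..R, entropy v u θ w b x 0 ≤ E₀)
    (x₀ : ℝ) {t : ℝ} (ht : t ∈ Icc (0:ℝ) T) :
    ∫ x in x₀..(x₀ + 1), entropy v u θ w b x t ≤ 2 * (E₀ + 1) := by
  have h0 : (0:ℝ) ∈ Icc (0:ℝ) T := left_mem_Icc.2 hT.le
  obtain ⟨C, hC, herr⟩ := abs_mul_abs_le_of_tendsto_zero (ε := 1 / (16 * T)) (by positivity)
    h.continuousOn_flux_error h.tendsto_flux_error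
  set R : ℝ := 1 + 16 * T * C + 2 * (|x₀| + 1) with hRdef
  have hTC : 0 ≤ 16 * T * C := by positivity
  have hx₀ := abs_nonneg x₀
  have hR : 1 ≤ R := by linarith
  have hR0 : 0 < R := by linarith
  set ψ : ℝ → ℝ := fun x => (1 - x ^ 2 / R ^ 2) ^ 2 with hψ
  have hψc : Continuous ψ := by simp only [hψ]; fun_prop
  have hηc : ∀ {s}, s ∈ Icc (0:ℝ) T → Continuous (fun x => entropy v u θ w b x s) := fun hs =>
    continuous_slice_of_strip h.continuousOn_entropy hs
  have hint : ∀ {s}, s ∈ Icc (0:ℝ) T → ∀ c d : ℝ,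
      IntervalIntegrable (fun x => ψ x * entropy v u θ w b x s) volume c d := fun hs _ _ =>
    (hψc.mul (hηc hs)).intervalIntegrable _ _
  have hstrip : ContinuousOn (fun p : ℝ × ℝ => ψ p.1 * entropyRate T v u θ w b p.1 p.2)
      (univ ×ˢ Icc 0 T) :=
    (hψc.comp continuous_fst).continuousOn.mul h.continuousOn_entropyRate
  have hkey := integral_sub_eq_integral_integral_deriv ht (-R) R
    (g := fun x s => ψ x * entropy v u θ w b x s)
    (g' := fun x s => ψ x * entropyRate T v u θ w b x s)
    (fun x s hs => (h.hasDerivWithinAt_entropy x hs).const_mul (ψ x)) hstrip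
  have hbound : ∫ s in (0:ℝ)..t, ∫ x in -R..R, ψ x * entropyRate T v u θ w b x s ≤ 1 := by
    have hsub : Icc (0:ℝ) t ⊆ Icc 0 T := Icc_subset_Icc_right ht.2
    calc _ ≤ ∫ s in (0:ℝ)..t, 8 * (C / R + 1 / (16 * T)) := by
          apply intervalIntegral.integral_mono_on ht.1
          · apply ContinuousOn.intervalIntegrable
            rw [uIcc_of_le ht.1]
            exact (continuousOn_integral_of_strip hT.le (-R) R hstrip).mono hsub
          · exact intervalIntegrable_const
          · intro s hs
            exact h.integral_weighted_entropyRate_le hα hT (hsub hs) hR (by positivity)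
              fun x => herr x s (hsub hs)
      _ = t * (8 * (C / R + 1 / (16 * T))) := by
          rw [intervalIntegral.integral_const, smul_eq_mul, sub_zero]
      _ ≤ T * (8 * (1 / (16 * T) + 1 / (16 * T))) := by
          have : C / R ≤ 1 / (16 * T) := by
            rw [div_le_div_iff₀ hR0 (by positivity)]
            linarith
          have h2 := ht.2
          gcongr
      _ = 1 := by field_simp; norm_num
  rw [← hkey, intervalIntegral.integral_sub (hint ht _ _) (hint h0 _ _)] at hbound
  have hinit : ∫ x in -R..R, ψ x * entropy v u θ w b x 0 ≤ E₀ := by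
    refine le_trans ?_ (hE₀ R hR0.le)
    apply intervalIntegral.integral_mono_on (by linarith)
      (hint h0 _ _) ((hηc h0).intervalIntegrable _ _)
    intro x hx
    have hx2 : x ^ 2 ≤ R ^ 2 := sq_le_sq' hx.1 hx.2
    have h1 : x ^ 2 / R ^ 2 ≤ 1 := (div_le_one (by positivity)).2 hx2
    have h2 : 0 ≤ x ^ 2 / R ^ 2 := by positivity
    have h3 : ψ x ≤ 1 := by simp only [hψ]; nlinarith
    exact mul_le_of_le_one_left (h.entropy_nonneg x h0) h3
  have hx₁ := neg_abs_le x₀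
  have hx₂ := le_abs_self x₀
  have hlower : ∫ x in x₀..(x₀ + 1), entropy v u θ w b x t / 2
      ≤ ∫ x in -R..R, ψ x * entropy v u θ w b x t := by
    calc _ ≤ ∫ x in x₀..(x₀ + 1), ψ x * entropy v u θ w b x t := by
          apply intervalIntegral.integral_mono_on (by linarith)
            (((hηc ht).div_const 2).intervalIntegrable _ _)
            (hint ht _ _)
          intro x hx
          have hxa : |x| ≤ |x₀| + 1 := abs_le.2 ⟨by linarith [hx.1], by linarith [hx.2]⟩
          have h1 : x ^ 2 / R ^ 2 ≤ 1 / 4 := by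
            rw [div_le_div_iff₀ (by positivity) (by norm_num), ← sq_abs x]
            have : 2 * |x| ≤ R := by linarith
            nlinarith [abs_nonneg x]
          have h3 : 1 / 2 ≤ ψ x := by simp only [hψ]; nlinarith
          have := mul_le_mul_of_nonneg_right h3 (h.entropy_nonneg x ht)
          linarith
      _ ≤ _ := by
          apply intervalIntegral.integral_mono_interval (by linarith) (by linarith)
            (by linarith)
          · exact ae_of_all _ fun x => mul_nonneg (sq_nonneg _) (h.entropy_nonneg x ht)
          · exact hint ht _ _
  rw [intervalIntegral.integral_div] at hlower
  linarith

end IsClassicalSolution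

/-! ### Initial entropy -/

/-- Integrand of the squared `H¹` norm of the initial data. -/
def initialDensity (v u θ : ℝ → ℝ → ℝ) (w b : ℝ → ℝ → ℝ × ℝ) (x : ℝ) : ℝ :=
  (v x 0 - 1) ^ 2 + (u x 0) ^ 2 + (θ x 0 - 1) ^ 2 + sq2 (b x 0) + sq2 (w x 0)
      + (pdx v x 0) ^ 2 + (pdx u x 0) ^ 2 + (pdx θ x 0) ^ 2
      + sq2 (pdx b x 0) + sq2 (pdx w x 0)

theorem sub_one_sub_log_le_sq_div {z δ : ℝ} (hδ : 0 < δ) (hz : δ ≤ z) :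
    z - 1 - Real.log z ≤ (z - 1) ^ 2 / δ := by
  have hz0 : 0 < z := hδ.trans_le hz
  have h1 := Real.one_sub_inv_le_log_of_pos hz0
  calc z - 1 - Real.log z ≤ z - 1 - (1 - z⁻¹) := by linarith
    _ = (z - 1) ^ 2 / z := by field_simp
    _ ≤ (z - 1) ^ 2 / δ := by gcongr

namespace IsClassicalSolution

variable {α β T K δ : ℝ} {v u θ : ℝ → ℝ → ℝ} {w b : ℝ → ℝ → ℝ × ℝ}

theorem integral_initialDensity_le (h : IsClassicalSolution α β T v u θ w b)
    (hT : 0 < T) (hadm : Admissible K δ v u θ w b) {y x : ℝ} (hyx : y ≤ x) :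
    IntervalIntegrable (initialDensity v u θ w b) volume y x ∧
      ∫ z in y..x, initialDensity v u θ w b z ≤ K ^ 2 := by
  obtain ⟨h1, h2, h3, h4, h5, h6, h7, h8, h9, h10⟩ := h.sq_int 0 (left_mem_Icc.2 hT.le)
  have hint : Integrable (initialDensity v u θ w b) :=
    ((((((((h1.add h2).add h3).add h4).add h5).add h6).add h7).add h8).add h9).add h10
  refine ⟨hint.intervalIntegrable, ?_⟩
  rw [intervalIntegral.integral_of_le hyx]
  refine (setIntegral_le_integral hint (ae_of_all _ fun z => ?_)).trans hadm.1
  have hb := sq2_nonneg (b z 0)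
  have hw := sq2_nonneg (w z 0)
  have hbx := sq2_nonneg (pdx b z 0)
  have hwx := sq2_nonneg (pdx w z 0)
  simp only [initialDensity, Pi.zero_apply]
  positivity

theorem initial_v_le (h : IsClassicalSolution α β T v u θ w b)
    (hT : 0 < T) (hadm : Admissible K δ v u θ w b) (x : ℝ) : v x 0 ≤ 2 + K ^ 2 := by
  have h0 : (0:ℝ) ∈ Icc (0:ℝ) T := left_mem_Icc.2 hT.le
  obtain ⟨M, hM⟩ := h.farfield 1 one_pos
  set y : ℝ := -(|x| + |M|) with hy
  have hyx : y ≤ x := by linarith [neg_abs_le x, abs_nonneg M]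
  have hyM : M ≤ |y| := by
    rw [hy, abs_neg]
    exact (le_abs_self M).trans ((le_add_of_nonneg_left (abs_nonneg x)).trans (le_abs_self _))
  have hfy := (hM y 0 h0 hyM).1
  have hfy2 : (v y 0 - 1) ^ 2 ≤ 1 := by
    rw [← sq_abs]
    nlinarith [abs_nonneg (v y 0 - 1)]
  obtain ⟨hint, hle⟩ := h.integral_initialDensity_le hT hadm hyx
  have hvc : Continuous (fun z => v z 0) := continuous_slice_of_strip h.continuousOn_v h0
  have hvxc : Continuous (fun z => pdx v z 0) := continuous_slice_of_strip h.cont_dx.fst h0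
  have hii : IntervalIntegrable (fun z => 2 * (v z 0 - 1) * pdx v z 0) volume y x :=
    Continuous.intervalIntegrable (by fun_prop) _ _
  have hftc : ∫ z in y..x, 2 * (v z 0 - 1) * pdx v z 0 = (v x 0 - 1) ^ 2 - (v y 0 - 1) ^ 2 := by
    apply intervalIntegral.integral_eq_sub_of_hasDerivAt (f := fun z => (v z 0 - 1) ^ 2) _ hii
    intro z _
    exact (((h.hasDerivAt_v z h0).sub_const 1).pow 2).congr_deriv (by simp)
  have hmono : ∫ z in y..x, 2 * (v z 0 - 1) * pdx v z 0
      ≤ ∫ z in y..x, initialDensity v u θ w b z := by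
    apply intervalIntegral.integral_mono_on hyx hii hint
    intro z _
    have hb := sq2_nonneg (b z 0)
    have hw := sq2_nonneg (w z 0)
    have hbx := sq2_nonneg (pdx b z 0)
    have hwx := sq2_nonneg (pdx w z 0)
    simp only [initialDensity]
    linarith [sq_nonneg (v z 0 - 1 - pdx v z 0), sq_nonneg (u z 0), sq_nonneg (θ z 0 - 1),
      sq_nonneg (pdx u z 0), sq_nonneg (pdx θ z 0)]
  nlinarith [sq_nonneg (v x 0 - 1 - 1)]

theorem integral_initial_entropy_le (h : IsClassicalSolution α β T v u θ w b)
    (hT : 0 < T) (hδ : 0 < δ) (hadm : Admissible K δ v u θ w b) {R : ℝ} (hR : 0 ≤ R) :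
    ∫ x in -R..R, entropy v u θ w b x 0 ≤ (1 / δ + 2 + K ^ 2) * K ^ 2 := by
  have h0 : (0:ℝ) ∈ Icc (0:ℝ) T := left_mem_Icc.2 hT.le
  have hRR : -R ≤ R := by linarith
  obtain ⟨hint, hle⟩ := h.integral_initialDensity_le hT hadm hRR
  have hηc : Continuous (fun x => entropy v u θ w b x 0) :=
    continuous_slice_of_strip h.continuousOn_entropy h0
  calc ∫ x in -R..R, entropy v u θ w b x 0
      ≤ ∫ x in -R..R, (1 / δ + 2 + K ^ 2) * initialDensity v u θ w b x := by
        apply intervalIntegral.integral_mono_on hRR (hηc.intervalIntegrable _ _)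
          (hint.const_mul _)
        intro x _
        have h1 := sub_one_sub_log_le_sq_div hδ (hadm.2.1 x)
        have h2 := sub_one_sub_log_le_sq_div hδ (hadm.2.2 x)
        have h3 := h.initial_v_le hT hadm x
        have hb := sq2_nonneg (b x 0)
        have hw := sq2_nonneg (w x 0)
        have hbx := sq2_nonneg (pdx b x 0)
        have hwx := sq2_nonneg (pdx w x 0)
        have hk : 1 / δ + 2 + K ^ 2 ≥ 1 / δ ∧ 1 / δ + 2 + K ^ 2 ≥ 1 ∧
            1 / δ + 2 + K ^ 2 ≥ 2 + K ^ 2 := by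
          have : 0 < 1 / δ := by positivity
          refine ⟨?_, ?_, ?_⟩ <;> nlinarith [sq_nonneg K]
        obtain ⟨hk1, hk2, hk3⟩ := hk
        rw [div_eq_mul_one_div] at h1 h2
        have e1 := mul_le_mul_of_nonneg_right hk1 (sq_nonneg (v x 0 - 1))
        have e2 := mul_le_mul_of_nonneg_right hk1 (sq_nonneg (θ x 0 - 1))
        have e3 := mul_le_mul_of_nonneg_right hk2 (sq_nonneg (u x 0))
        have e4 := mul_le_mul_of_nonneg_right hk3 hb
        have e5 := mul_le_mul_of_nonneg_right hk2 hw
        have e6 := mul_le_mul_of_nonneg_right h3 hb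
        have e7 : 0 ≤ (1 / δ + 2 + K ^ 2) * ((pdx v x 0) ^ 2 + (pdx u x 0) ^ 2
            + (pdx θ x 0) ^ 2 + sq2 (pdx b x 0) + sq2 (pdx w x 0)) :=
          mul_nonneg (by linarith) (by positivity)
        have e8 := mul_nonneg (h.v_pos x 0 h0).le hb
        simp only [entropy, initialDensity]
        linarith [sq_nonneg (u x 0)]
    _ = (1 / δ + 2 + K ^ 2) * ∫ x in -R..R, initialDensity v u θ w b x :=
        intervalIntegral.integral_const_mul _ _
    _ ≤ (1 / δ + 2 + K ^ 2) * K ^ 2 := by gcongr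

end IsClassicalSolution

/-! ### Lower bound for the specific volume -/

/-- Primitive of `z ↦ μ(z) / z` on `(0, ∞)`. -/
def viscPotential (α z : ℝ) : ℝ := Real.log z - z ^ (-α)

theorem exp_viscPotential_le {α z : ℝ} (hz : 0 < z) : Real.exp (viscPotential α z) ≤ z := by
  conv_rhs => rw [← Real.exp_log hz]
  exact Real.exp_le_exp.2 (sub_le_self _ (Real.rpow_nonneg hz.le _))

theorem viscPotential_le {α z : ℝ} (hz : 0 < z) : viscPotential α z ≤ z := by
  have h1 := Real.rpow_nonneg hz.le (-α)
  have h2 := Real.log_le_sub_one_of_pos hz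
  simp only [viscPotential]
  linarith

theorem viscPotential_mono {α y z : ℝ} (hα : 0 ≤ α) (hy : 0 < y) (hyz : y ≤ z) :
    viscPotential α y ≤ viscPotential α z :=
  sub_le_sub (Real.log_le_log hy hyz)
    (Real.rpow_le_rpow_of_nonpos hy hyz (neg_nonpos.2 hα))

theorem le_exp_viscPotential {α E z : ℝ} (hα : 0 ≤ α) (hE : 0 < E) (hz : 0 < z) :
    Real.exp (viscPotential α (Real.exp (-1 - 2 * E))) * (1 - (z - 1 - Real.log z) / (2 * E))
      ≤ Real.exp (viscPotential α z) := by
  have hlog := sub_one_sub_log_nonneg hz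
  rcases le_or_gt (Real.exp (-1 - 2 * E)) z with h | h
  · have h1 : 1 - (z - 1 - Real.log z) / (2 * E) ≤ 1 := by
      have : 0 ≤ (z - 1 - Real.log z) / (2 * E) := by positivity
      linarith
    exact (mul_le_of_le_one_right (Real.exp_pos _).le h1).trans
      (Real.exp_le_exp.2 (viscPotential_mono hα (Real.exp_pos _) h))
  · have h1 : Real.log z < -1 - 2 * E := (Real.log_lt_iff_lt_exp hz).2 h
    have h2 : 1 ≤ (z - 1 - Real.log z) / (2 * E) := by
      rw [le_div_iff₀ (by positivity)]
      linarith
    exact (mul_nonpos_of_nonneg_of_nonpos (Real.exp_pos _).le (by linarith)).trans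
      (Real.exp_pos _).le

namespace IsClassicalSolution

variable {α β T : ℝ} {v u θ : ℝ → ℝ → ℝ} {w b : ℝ → ℝ → ℝ × ℝ}

theorem hasDerivWithinAt_viscPotential (h : IsClassicalSolution α β T v u θ w b) (x : ℝ) {t : ℝ}
    (ht : t ∈ Icc (0:ℝ) T) : HasDerivWithinAt (fun s => viscPotential α (v x s))
      (viscousStress α v u x t) (Icc 0 T) t := by
  have hv := h.hasDerivWithinAt_v x ht
  have hv0 := (h.v_pos x t ht).ne'
  refine ((hv.log hv0).sub (hv.rpow_const (p := -α) (Or.inl hv0))).congr_deriv ?_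
  rw [Real.rpow_sub_one hv0]
  simp only [viscousStress, visc]
  field_simp
  ring

/-- The momentum equation integrated in space and time. -/
theorem viscPotential_eq (h : IsClassicalSolution α β T v u θ w b) (x₀ x : ℝ) {t : ℝ}
    (ht : t ∈ Icc (0:ℝ) T) :
    viscPotential α (v x t) = viscPotential α (v x 0) + (∫ y in x₀..x, (u y t - u y 0))
      + (viscPotential α (v x₀ t) - viscPotential α (v x₀ 0)
        - ∫ s in (0:ℝ)..t, totalPressure v θ b x₀ s)
      + ∫ s in (0:ℝ)..t, totalPressure v θ b x s := by
  have hsub : Icc (0:ℝ) t ⊆ Icc 0 T := Icc_subset_Icc_right ht.2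
  have hii : ∀ {f : ℝ → ℝ}, ContinuousOn f (Icc 0 T) → IntervalIntegrable f volume 0 t := by
    intro f hf
    apply ContinuousOn.intervalIntegrable
    rw [uIcc_of_le ht.1]
    exact hf.mono hsub
  have hσ : ∀ y, ContinuousOn (fun s => viscousStress α v u y s) (Icc 0 T) := fun y =>
    continuousOn_slice_of_strip h.continuousOn_viscousStress y
  have hP : ∀ y, ContinuousOn (fun s => totalPressure v θ b y s) (Icc 0 T) := fun y =>
    continuousOn_slice_of_strip h.continuousOn_totalPressure y
  have hD : ∀ y, ContinuousOn (fun s => viscousStress α v u y s - totalPressure v θ b y s)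
      (Icc 0 T) := fun y => (hσ y).sub (hP y)
  have hFTC : ∀ y, ∫ s in (0:ℝ)..t, viscousStress α v u y s
      = viscPotential α (v y t) - viscPotential α (v y 0) := fun y =>
    integral_eq_sub_of_hasDerivWithinAt_Icc ht
      (fun s hs => h.hasDerivWithinAt_viscPotential y hs) (hσ y)
  have hspace : ∀ s ∈ Icc (0:ℝ) T, ∫ y in x₀..x, pdt T u y s
      = (viscousStress α v u x s - totalPressure v θ b x s)
        - (viscousStress α v u x₀ s - totalPressure v θ b x₀ s) := fun s hs =>
    intervalIntegral.integral_eq_sub_of_hasDerivAt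
      (fun y _ => h.hasDerivAt_stress_sub_pressure y hs)
      ((continuous_slice_of_strip h.continuousOn_pdt_u hs).intervalIntegrable _ _)
  rw [integral_sub_eq_integral_integral_deriv ht x₀ x (g := u) (g' := pdt T u)
    (fun y s hs => h.hasDerivWithinAt_u y hs) h.continuousOn_pdt_u]
  have hcongr : ∫ s in (0:ℝ)..t, ∫ y in x₀..x, pdt T u y s
      = ∫ s in (0:ℝ)..t, ((viscousStress α v u x s - totalPressure v θ b x s)
        - (viscousStress α v u x₀ s - totalPressure v θ b x₀ s)) := by
    refine intervalIntegral.integral_congr fun s hs => hspace s ?_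
    rw [uIcc_of_le ht.1] at hs
    exact hsub hs
  rw [hcongr, intervalIntegral.integral_sub (hii (hD x)) (hii (hD x₀)),
    intervalIntegral.integral_sub (hii (hσ x)) (hii (hP x)),
    intervalIntegral.integral_sub (hii (hσ x₀)) (hii (hP x₀)), hFTC, hFTC]
  ring

end IsClassicalSolution

theorem exists_lower_bound_v (α T E δ V : ℝ) (hα : 0 ≤ α) (hT : 0 < T) (hE : 0 < E)
    (hδ : 0 < δ) :
    ∃ c : ℝ, 0 < c ∧ ∀ (β : ℝ) (v u θ : ℝ → ℝ → ℝ) (w b : ℝ → ℝ → ℝ × ℝ),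
      IsClassicalSolution α β T v u θ w b →
      (∀ x₀, ∀ t ∈ Icc (0:ℝ) T, ∫ x in x₀..(x₀ + 1), entropy v u θ w b x t ≤ E) →
      (∀ x, δ ≤ v x 0) → (∀ x, v x 0 ≤ V) → ∀ x, ∀ t ∈ Icc (0:ℝ) T, c ≤ v x t := by
  set L : ℝ := viscPotential α δ - (2 * E + 1) with hL
  set U : ℝ := V + (2 * E + 1) with hU
  set ε : ℝ := Real.exp (viscPotential α (Real.exp (-1 - 2 * E))) with hε
  have hε0 : 0 < ε := Real.exp_pos _
  set A : ℝ := 2 / ε * Real.exp U with hA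
  have hA0 : 0 < A := by positivity
  set C : ℝ := (2 * E + 2) * Real.exp (-L) * A with hC
  have hC0 : 0 < C := by positivity
  refine ⟨Real.exp L / (A * Real.exp (C * T)), by positivity, ?_⟩
  intro β v u θ w b h hent hlow hupp x₀ t ht
  have h0 : (0:ℝ) ∈ Icc (0:ℝ) T := left_mem_Icc.2 hT.le
  have hx₀ : x₀ ≤ x₀ + 1 := by linarith
  have hηc : ∀ {s}, s ∈ Icc (0:ℝ) T → Continuous (fun x => entropy v u θ w b x s) := fun hs =>
    continuous_slice_of_strip h.continuousOn_entropy hs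
  obtain ⟨P, hPc, hP⟩ := exists_continuous_extension_strip hT.le h.continuousOn_totalPressure
  simp only at hP
  have hPc' : ∀ x, Continuous (P x) := fun x => hPc.comp (by fun_prop : Continuous (Prod.mk x))
  -- `Z` is the exponential of the pressure impulse
  set Z : ℝ → ℝ → ℝ := fun x s => Real.exp (∫ r in (0:ℝ)..s, P x r) with hZ
  have hZc : Continuous (Function.uncurry Z) :=
    Real.continuous_exp.comp (intervalIntegral.continuous_parametric_primitive_of_continuous hPc)
  have hZd : ∀ x s, HasDerivAt (Z x) (P x s * Z x s) s := by
    intro x s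
    have h1 : HasDerivAt (fun s => ∫ r in (0:ℝ)..s, P x r) (P x s) s :=
      intervalIntegral.integral_hasDerivAt_right ((hPc' x).intervalIntegrable _ _)
        ((hPc' x).stronglyMeasurableAtFilter _ _) (hPc' x).continuousAt
    exact h1.exp.congr_deriv (mul_comm _ _)
  have hPZc : Continuous (Function.uncurry fun x s => P x s * Z x s) := hPc.mul hZc
  have hPint : ∀ x, ∀ s ∈ Icc (0:ℝ) T, ∫ r in (0:ℝ)..s, totalPressure v θ b x r
      = ∫ r in (0:ℝ)..s, P x r := by
    intro x s hs
    refine intervalIntegral.integral_congr fun r hr => (hP x r ?_).symm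
    rw [uIcc_of_le hs.1] at hr
    exact ⟨hr.1, hr.2.trans hs.2⟩
  set Y : ℝ → ℝ := fun s => viscPotential α (v x₀ s) - viscPotential α (v x₀ 0)
    - ∫ r in (0:ℝ)..s, totalPressure v θ b x₀ r with hY
  have hvel : ∀ s ∈ Icc (0:ℝ) T, ∀ x ∈ Icc x₀ (x₀ + 1),
      |∫ y in x₀..x, (u y s - u y 0)| ≤ 2 * E + 1 := by
    intro s hs x hx
    have huc : ∀ {r}, r ∈ Icc (0:ℝ) T → Continuous (fun y => u y r) := fun hr =>
      continuous_slice_of_strip h.continuousOn_u hr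
    have hsum : Continuous (fun y => entropy v u θ w b y s + entropy v u θ w b y 0 + 1) :=
      ((hηc hs).add (hηc h0)).add continuous_const
    have hdiff : Continuous (fun y => |u y s - u y 0|) := ((huc hs).sub (huc h0)).abs
    calc |∫ y in x₀..x, (u y s - u y 0)| ≤ ∫ y in x₀..x, |u y s - u y 0| :=
          intervalIntegral.abs_integral_le_integral_abs hx.1
      _ ≤ ∫ y in x₀..x, (entropy v u θ w b y s + entropy v u θ w b y 0 + 1) := by
          apply intervalIntegral.integral_mono_on hx.1
            (hdiff.intervalIntegrable _ _) (hsum.intervalIntegrable _ _)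
          intro y _
          have h1 := h.abs_u_le_entropy y hs
          have h2 := h.abs_u_le_entropy y h0
          have h3 := abs_sub (u y s) (u y 0)
          linarith
      _ ≤ ∫ y in x₀..(x₀ + 1), (entropy v u θ w b y s + entropy v u θ w b y 0 + 1) := by
          apply intervalIntegral.integral_mono_interval le_rfl hx.1 hx.2 _
            (hsum.intervalIntegrable _ _)
          refine ae_of_all _ fun y => ?_
          have h1 := h.entropy_nonneg y hs
          have h2 := h.entropy_nonneg y h0
          simp only [Pi.zero_apply]
          linarith
      _ = (∫ y in x₀..(x₀ + 1), entropy v u θ w b y s)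
          + (∫ y in x₀..(x₀ + 1), entropy v u θ w b y 0) + 1 := by
          have i1 := (hηc hs).intervalIntegrable (μ := volume) x₀ (x₀ + 1)
          have i2 := (hηc h0).intervalIntegrable (μ := volume) x₀ (x₀ + 1)
          rw [intervalIntegral.integral_add (i1.add i2) intervalIntegrable_const,
            intervalIntegral.integral_add i1 i2, intervalIntegral.integral_const]
          simp
      _ ≤ 2 * E + 1 := by linarith [hent x₀ s hs, hent x₀ 0 h0]
  have hbounds : ∀ s ∈ Icc (0:ℝ) T, ∀ x ∈ Icc x₀ (x₀ + 1),
      Real.exp (L + Y s) * Z x s ≤ Real.exp (viscPotential α (v x s)) ∧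
      Real.exp (viscPotential α (v x s)) ≤ Real.exp (U + Y s) * Z x s := by
    intro s hs x hx
    have h1 := abs_le.1 (hvel s hs x hx)
    have h2 : viscPotential α δ ≤ viscPotential α (v x 0) := viscPotential_mono hα hδ (hlow x)
    have h3 : viscPotential α (v x 0) ≤ V := (viscPotential_le (h.v_pos x 0 h0)).trans (hupp x)
    have h4 := h.viscPotential_eq x₀ x hs
    rw [hPint x s hs] at h4
    simp only [hZ, ← Real.exp_add, Real.exp_le_exp]
    have hYs : Y s = viscPotential α (v x₀ s) - viscPotential α (v x₀ 0)
      - ∫ r in (0:ℝ)..s, totalPressure v θ b x₀ r := rfl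
    rw [← hYs] at h4
    constructor <;> linarith
  set z : ℝ → ℝ := fun s => ∫ x in x₀..(x₀ + 1), Z x s with hz
  set q : ℝ → ℝ := fun s => ∫ x in x₀..(x₀ + 1), P x s * Z x s with hq
  have hZs : ∀ s, Continuous (fun x => Z x s) := fun s => hZc.comp (by fun_prop :
    Continuous fun x : ℝ => (x, s))
  have hPZs : ∀ s, Continuous (fun x => P x s * Z x s) := fun s => hPZc.comp (by fun_prop :
    Continuous fun x : ℝ => (x, s))
  have hqc : Continuous q :=
    intervalIntegral.continuous_parametric_intervalIntegral_of_continuous'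
      (f := fun s x => P x s * Z x s) (hPZc.comp continuous_swap) _ _
  have hzq : ∀ s ∈ Icc (0:ℝ) T, z s = 1 + ∫ r in (0:ℝ)..s, q r := by
    intro s hs
    have h1 := integral_sub_eq_integral_integral_deriv hs x₀ (x₀ + 1) (g := Z)
      (g' := fun x s => P x s * Z x s) (fun x r _ => (hZd x r).hasDerivWithinAt)
      hPZc.continuousOn
    have h2 : ∀ x, Z x 0 = 1 := by simp [hZ]
    simp only [h2] at h1
    rw [intervalIntegral.integral_sub ((hZs s).intervalIntegrable _ _)
      intervalIntegrable_const, intervalIntegral.integral_const] at h1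
    simp only [add_sub_cancel_left, smul_eq_mul, mul_one] at h1
    simp only [hz, hq]
    linarith
  have hYz : ∀ s ∈ Icc (0:ℝ) T, Real.exp (-Y s) ≤ A * z s := by
    intro s hs
    have hi := (hηc hs).intervalIntegrable (μ := volume) x₀ (x₀ + 1)
    have h1 : ε / 2 ≤ Real.exp (U + Y s) * z s := by
      calc ε / 2 = ε * (1 - E / (2 * E)) := by field_simp; norm_num
        _ ≤ ε * (1 - (∫ x in x₀..(x₀ + 1), entropy v u θ w b x s) / (2 * E)) := by
            have := hent x₀ s hs
            gcongr
        _ = ∫ x in x₀..(x₀ + 1), ε * (1 - entropy v u θ w b x s / (2 * E)) := by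
            rw [intervalIntegral.integral_const_mul, intervalIntegral.integral_sub
              intervalIntegrable_const (hi.div_const _), intervalIntegral.integral_const,
              intervalIntegral.integral_div]
            simp
        _ ≤ ∫ x in x₀..(x₀ + 1), Real.exp (U + Y s) * Z x s := by
            apply intervalIntegral.integral_mono_on hx₀
              ((intervalIntegrable_const.sub (hi.div_const _)).const_mul _)
              (((hZs s).const_mul _).intervalIntegrable _ _)
            intro x hx
            refine le_trans ?_ (hbounds s hs x hx).2
            refine le_trans ?_ (le_exp_viscPotential hα hE (h.v_pos x s hs))
            have := h.sub_one_sub_log_le_entropy x hs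
            gcongr
        _ = Real.exp (U + Y s) * z s := intervalIntegral.integral_const_mul _ _
    calc Real.exp (-Y s) = 2 / ε * Real.exp (-Y s) * (ε / 2) := by field_simp
      _ ≤ 2 / ε * Real.exp (-Y s) * (Real.exp (U + Y s) * z s) := by gcongr
      _ = A * z s * (Real.exp (-Y s) * Real.exp (Y s)) := by rw [hA, Real.exp_add]; ring
      _ = A * z s := by rw [← Real.exp_add]; simp
  have hP0 : ∀ x, ∀ s ∈ Icc (0:ℝ) T, 0 ≤ P x s := by
    intro x s hs
    rw [hP x s hs]
    have h1 := h.v_pos x s hs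
    have h2 := h.θ_pos x s hs
    have h3 := sq2_nonneg (b x s)
    simp only [totalPressure]
    positivity
  have hqz : ∀ s ∈ Icc (0:ℝ) T, q s ≤ C * z s := by
    intro s hs
    have hi := (hηc hs).intervalIntegrable (μ := volume) x₀ (x₀ + 1)
    calc q s ≤ ∫ x in x₀..(x₀ + 1),
          (2 * entropy v u θ w b x s + 2) * (Real.exp (-L) * Real.exp (-Y s)) := by
          apply intervalIntegral.integral_mono_on hx₀ ((hPZs s).intervalIntegrable _ _)
            (((hi.const_mul 2).add intervalIntegrable_const).mul_const _)
          intro x hx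
          have h1 : Z x s ≤ v x s * (Real.exp (-L) * Real.exp (-Y s)) := by
            have h2 := (hbounds s hs x hx).1.trans (exp_viscPotential_le (h.v_pos x s hs))
            calc Z x s = Real.exp (L + Y s) * Z x s * (Real.exp (-L) * Real.exp (-Y s)) := by
                  rw [mul_right_comm, ← Real.exp_add, ← Real.exp_add]
                  ring_nf
                  simp
              _ ≤ _ := by gcongr
          calc P x s * Z x s ≤ P x s * (v x s * (Real.exp (-L) * Real.exp (-Y s))) := by
                have := hP0 x s hs
                gcongr
            _ = totalPressure v θ b x s * v x s * (Real.exp (-L) * Real.exp (-Y s)) := by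
                rw [hP x s hs]
                ring
            _ ≤ _ := by
                have := h.pressure_mul_v_le_entropy x hs
                gcongr
      _ = (2 * (∫ x in x₀..(x₀ + 1), entropy v u θ w b x s) + 2)
          * (Real.exp (-L) * Real.exp (-Y s)) := by
          rw [intervalIntegral.integral_mul_const, intervalIntegral.integral_add
            (hi.const_mul 2) intervalIntegrable_const, intervalIntegral.integral_const_mul,
            intervalIntegral.integral_const]
          simp
      _ ≤ (2 * E + 2) * (Real.exp (-L) * (A * z s)) := by
          have h1 := hent x₀ s hs
          have h2 := hYz s hs
          gcongr
      _ = C * z s := by rw [hC]; ring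
  have hzt := le_mul_exp_of_eq_add_integral hqc hzq hqz ht
  have hexp : Real.exp (C * t) ≤ Real.exp (C * T) := by
    have := ht.2
    gcongr
  have hYt : Real.exp (-Y t) ≤ A * Real.exp (C * T) :=
    (hYz t ht).trans (mul_le_mul_of_nonneg_left (by linarith) hA0.le)
  have hZ1 : 1 ≤ Z x₀ t := by
    apply Real.one_le_exp
    exact intervalIntegral.integral_nonneg ht.1
      fun r hr => hP0 x₀ r ⟨hr.1, hr.2.trans ht.2⟩
  calc Real.exp L / (A * Real.exp (C * T)) ≤ Real.exp L / Real.exp (-Y t) := by gcongr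
    _ = Real.exp (L + Y t) * 1 := by rw [← Real.exp_sub, sub_neg_eq_add, mul_one]
    _ ≤ Real.exp (L + Y t) * Z x₀ t := by gcongr
    _ ≤ Real.exp (viscPotential α (v x₀ t)) := (hbounds t ht x₀ ⟨le_rfl, hx₀⟩).1
    _ ≤ v x₀ t := exp_viscPotential_le (h.v_pos x₀ t ht)

/-! ### Minimum principle for the temperature -/

theorem hasDerivWithinAt_nonneg_of_forall_le {f : ℝ → ℝ} {f' t T : ℝ} (ht : t ∈ Ioc 0 T)
    (hf : HasDerivWithinAt f f' (Icc 0 T) t) (hmax : ∀ s ∈ Icc 0 T, f s ≤ f t) : 0 ≤ f' := by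
  have hloc : IsLocalMaxOn f (Icc 0 T) t :=
    IsMaxOn.localize (f := f) (s := Icc 0 T) (a := t) fun s hs => hmax s hs
  have h0 : (0:ℝ) ∈ Icc 0 T := ⟨le_rfl, ht.1.le.trans ht.2⟩
  have h1 := hloc.hasFDerivWithinAt_nonpos hf.hasFDerivWithinAt
    (sub_mem_posTangentConeAt_of_segment_subset
      ((convex_Icc (0:ℝ) T).segment_subset ⟨ht.1.le, ht.2⟩ h0))
  simp at h1
  nlinarith [ht.1]

namespace IsClassicalSolution

variable {α β T : ℝ} {v u θ : ℝ → ℝ → ℝ} {w b : ℝ → ℝ → ℝ × ℝ}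

/-- At a spatial minimum of the temperature, `θ_t` is bounded below by `-θ² / (4 v)`. -/
theorem neg_sq_div_le_pdt_θ_of_isLocalMin (h : IsClassicalSolution α β T v u θ w b) (hα : 0 ≤ α)
    {x t : ℝ} (ht : t ∈ Icc (0:ℝ) T) (hmin : IsLocalMin (fun y => θ y t) x) :
    -(θ x t ^ 2 / (4 * v x t)) ≤ pdt T θ x t := by
  have hv := h.v_pos x t ht
  have hθ := h.θ_pos x t ht
  have hx : pdx θ x t = 0 := hmin.deriv_eq_zero
  have hxx : 0 ≤ pdx (pdx θ) x t := nonneg_of_isLocalMin_of_hasDerivAt_deriv hmin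
    (h.hasDerivAt_θ x ht).continuousAt (h.hasDerivAt_pdx_θ x ht)
  have hflux := (((h.hasDerivAt_θ x ht).rpow_const (p := β) (Or.inl hθ.ne')).mul
    (h.hasDerivAt_pdx_θ x ht)).div (h.hasDerivAt_v x ht) hv.ne'
  have heq := (h.hasDerivAt_heat_flux x ht).unique hflux
  simp only [hx, mul_zero, zero_mul, zero_add, sub_zero, Pi.mul_apply] at heq
  have hrhs : 0 ≤ θ x t ^ β * pdx (pdx θ) x t * v x t / v x t ^ 2 := by positivity
  rw [← heq] at hrhs
  have hheat : pdx u x t ^ 2 ≤ heating α v u w b x t := by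
    have h1 := visc_ge_one hα hv.le
    have h2 := sq2_nonneg (pdx w x t)
    have h3 := sq2_nonneg (pdx b x t)
    have h4 := mul_le_mul_of_nonneg_right h1 (sq_nonneg (pdx u x t))
    simp only [heating]
    linarith
  have hheat' : pdx u x t ^ 2 / v x t ≤ heating α v u w b x t / v x t := by gcongr
  have hsq : 0 ≤ (pdx u x t - θ x t / 2) ^ 2 / v x t := by positivity
  have hid : (pdx u x t - θ x t / 2) ^ 2 / v x t
      = pdx u x t ^ 2 / v x t - θ x t / v x t * pdx u x t + θ x t ^ 2 / (4 * v x t) := by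
    field_simp
    ring
  linarith

/-- A lower bound for the specific volume gives a lower bound for the temperature. -/
theorem inv_θ_le (h : IsClassicalSolution α β T v u θ w b) (hα : 0 ≤ α) {c δ : ℝ} (hc : 0 < c)
    (hδ₀ : 0 < δ) (hδ₁ : δ ≤ 1) (hv : ∀ x, ∀ t ∈ Icc (0:ℝ) T, c ≤ v x t)
    (hθ₀ : ∀ x, δ ≤ θ x 0) (x : ℝ) {t : ℝ} (ht : t ∈ Icc (0:ℝ) T) :
    (θ x t)⁻¹ ≤ 2 / δ + T / c := by
  have hT : 0 ≤ T := ht.1.trans ht.2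
  obtain ⟨M, hM⟩ := h.farfield (1 / 2) (by norm_num)
  have hfar : ∀ y, ∀ s ∈ Icc (0:ℝ) T, M ≤ |y| → (θ y s)⁻¹ ≤ 2 / δ := by
    intro y s hs hy
    have h1 := (abs_lt.1 (hM y s hs hy).2.2.1).1
    have h2 : (2:ℝ) ≤ 2 / δ := by rw [le_div_iff₀ hδ₀]; linarith
    refine le_trans ?_ h2
    rw [inv_le_comm₀ (h.θ_pos y s hs) two_pos]
    linarith
  set R := max M |x| with hR
  have hxR : x ∈ Icc (-R) R := abs_le.1 (le_max_right _ _)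
  obtain ⟨⟨y, s⟩, ⟨hy, hs⟩, hmax⟩ := (isCompact_Icc.prod isCompact_Icc).exists_isMaxOn
    (⟨(x, t), hxR, ht⟩ : (Icc (-R) R ×ˢ Icc (0:ℝ) T).Nonempty)
    (f := fun p => (θ p.1 p.2)⁻¹ - p.2 / c)
    (((h.continuousOn_θ.inv₀ fun p hp => (h.θ_pos p.1 p.2 hp.2).ne').sub
      (continuousOn_snd.div_const c)).mono (prod_mono (subset_univ _) le_rfl))
  have hmax' : ∀ z ∈ Icc (-R) R, ∀ r ∈ Icc (0:ℝ) T,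
      (θ z r)⁻¹ - r / c ≤ (θ y s)⁻¹ - s / c :=
    fun z hz r hr => hmax (mk_mem_prod hz hr)
  have hsc : 0 ≤ s / c := div_nonneg hs.1 hc.le
  have htc : t / c ≤ T / c := by gcongr; exact ht.2
  suffices hkey : (θ y s)⁻¹ - s / c ≤ 2 / δ by linarith [hmax' x hxR t ht]
  rcases hs.1.eq_or_lt with rfl | hs0
  · have h1 : (θ y 0)⁻¹ ≤ δ⁻¹ := inv_anti₀ hδ₀ (hθ₀ y)
    have h2 : δ⁻¹ ≤ 2 / δ := by
      rw [inv_eq_one_div]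
      gcongr
      norm_num
    linarith
  by_cases hyM : M ≤ |y|
  · linarith [hfar y s hs hyM]
  exfalso
  have hyR : |y| < R := (not_le.1 hyM).trans_le (le_max_left _ _)
  have hθ := h.θ_pos y s hs
  have hmin : IsLocalMin (fun z => θ z s) y := by
    filter_upwards [Icc_mem_nhds (abs_lt.1 hyR).1 (abs_lt.1 hyR).2] with z hz
    have h1 : (θ z s)⁻¹ ≤ (θ y s)⁻¹ := by linarith [hmax' z hz s hs]
    exact (inv_le_inv₀ (h.θ_pos z s hs) hθ).1 h1
  have hspace := h.neg_sq_div_le_pdt_θ_of_isLocalMin hα hs hmin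
  have htime := hasDerivWithinAt_nonneg_of_forall_le ⟨hs0, hs.2⟩
    (((h.hasDerivWithinAt_θ y hs).inv hθ.ne').sub ((hasDerivWithinAt_id s _).div_const c))
    (hmax' y hy)
  have h1 : θ y s ^ 2 / (4 * v y s) ≤ θ y s ^ 2 / (4 * c) := by
    have := hv y s hs
    gcongr
  have h2 : -pdt T θ y s / θ y s ^ 2 ≤ 1 / (4 * c) := by
    rw [div_le_iff₀ (by positivity)]
    calc -pdt T θ y s ≤ θ y s ^ 2 / (4 * c) := by linarith
      _ = 1 / (4 * c) * θ y s ^ 2 := by ring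
  have h3 : 1 / (4 * c) < 1 / c := by
    gcongr
    linarith
  linarith

end IsClassicalSolution

/-- Lemma 2.3 of the paper: uniform lower bound for the temperature `θ`,
with a constant depending only on `T, α, β, K, δ`. -/
theorem temperature_lower_bound (α β T K δ : ℝ) (hα : 0 ≤ α) (hβ : 0 < β) (hT : 0 < T)
    (hK : 0 < K) (hδ₀ : 0 < δ) (hδ₁ : δ ≤ 1) :
    ∃ C : ℝ, 0 < C ∧
      ∀ (v u θ : ℝ → ℝ → ℝ) (w b : ℝ → ℝ → ℝ × ℝ),
        IsClassicalSolution α β T v u θ w b → Admissible K δ v u θ w b →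
        ∀ x : ℝ, ∀ t ∈ Icc (0:ℝ) T, C⁻¹ ≤ θ x t := by
  set E : ℝ := 2 * ((1 / δ + 2 + K ^ 2) * K ^ 2 + 1) with hE
  obtain ⟨c, hc, hlow⟩ := exists_lower_bound_v α T E δ (2 + K ^ 2) hα hT (by positivity) hδ₀
  refine ⟨2 / δ + T / c, by positivity, fun v u θ w b h hadm x t ht => ?_⟩
  have hv := hlow β v u θ w b h
    (fun x₀ t ht => h.integral_entropy_le hα hT
      (fun R hR => h.integral_initial_entropy_le hT hδ₀ hadm hR) x₀ ht)
    hadm.2.1 (h.initial_v_le hT hadm)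
  exact inv_le_of_inv_le₀ (h.θ_pos x t ht) (h.inv_θ_le hα hc hδ₀ hδ₁ hv hadm.2.2 x ht)
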